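/- arXiv:1111.6561 — 9 statements merged into one kernel-verified Lean document; each statement's English description precedes it below -/
import Mathlib

section
/- Let G = (V,E) be a connected simple graph with n = |V| ≥ 2 vertices and a specified vertex a ∈ V. Two spanning trees T_A and T_B of G are adjacent (i.e., their edge-intersection contains a tree on n−1 vertices including a) if and only if T_B can be obtained from T_A by deleting the unique edge of T_A incident to some leaf v ≠ a of T_A and adding an edge of G joining v to some vertex of G. -/
/-- `T` is a spanning tree of `G`: a subgraph of `G` (on the same vertex set) that is a tree. -/
def IsSpanningTree {V : Type*} (G T : SimpleGraph V) : Prop :=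
  T ≤ G ∧ T.IsTree

/-- Two spanning trees `TA`, `TB` of a graph on vertex set `V` (with distinguished vertex `a`)
are *adjacent* if their edge-intersection contains a tree on `|V| - 1` vertices including `a`:
there is a vertex set `W` of size `|V| - 1` containing `a` and a tree `S` on `W` all of whose
edges are edges of both `TA` and `TB`. -/
def TreesAdjacent {V : Type*} [Fintype V] (a : V) (TA TB : SimpleGraph V) : Prop :=
  ∃ W : Set V, a ∈ W ∧ W.ncard = Fintype.card V - 1 ∧
    ∃ S : SimpleGraph W, S.IsTree ∧
      ∀ u v : W, S.Adj u v → TA.Adj u v ∧ TB.Adj u v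

/-- In an acyclic graph, a vertex whose removal leaves a connected graph has at most one
neighbour. -/
theorem SimpleGraph.IsAcyclic.subsingleton_neighborSet {V : Type*} {T : SimpleGraph V}
    (hT : T.IsAcyclic) {v : V} (hv : (T.induce {v}ᶜ).Preconnected) :
    (T.neighborSet v).Subsingleton := by
  intro x hx y hy
  rw [SimpleGraph.mem_neighborSet] at hx hy
  by_contra hne
  have hbridge := SimpleGraph.isAcyclic_iff_forall_adj_isBridge.1 hT hx
  rw [SimpleGraph.isBridge_iff] at hbridge
  apply hbridge
  let f : T.induce {v}ᶜ →g T.deleteEdges {s(v, x)} :=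
    { toFun := Subtype.val
      map_rel' := by
        rintro ⟨p, hp⟩ ⟨q, hq⟩ hpq
        simp only [Set.mem_compl_iff, Set.mem_singleton_iff] at hp hq
        simp only [SimpleGraph.comap_adj, Function.Embedding.subtype_apply] at hpq
        simp [SimpleGraph.deleteEdges_adj, hpq, hp, hq] }
  have hyx : (T.deleteEdges {s(v, x)}).Reachable y x :=
    (hv ⟨y, hy.ne'⟩ ⟨x, hx.ne'⟩).map f
  have hvy : (T.deleteEdges {s(v, x)}).Adj v y := by
    simp [SimpleGraph.deleteEdges_adj, hy, Ne.symm hne, hx.ne]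
  exact hvy.reachable.trans hyx

/-- In a tree on at least two vertices, a vertex whose removal leaves a connected graph is a
leaf. -/
theorem SimpleGraph.IsTree.exists_neighborSet_eq_singleton {V : Type*} [Nontrivial V]
    {T : SimpleGraph V} (hT : T.IsTree) {v : V} (hv : (T.induce {v}ᶜ).Preconnected) :
    ∃ u, T.neighborSet v = {u} := by
  obtain ⟨u, hu⟩ := hT.connected.preconnected.exists_adj_of_nontrivial v
  exact ⟨u, (hT.isAcyclic.subsingleton_neighborSet hv).eq_singleton_of_mem hu⟩

/-- A spanning tree of an acyclic graph is the whole graph. -/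
theorem SimpleGraph.IsTree.eq_of_le_of_isAcyclic {V : Type*} {S T : SimpleGraph V}
    (hS : S.IsTree) (hT : T.IsAcyclic) (h : S ≤ T) : S = T :=
  (SimpleGraph.isTree_iff_maximal_isAcyclic.1 hS).2.eq_of_le hT h

/-- Two spanning trees `TA`, `TB` of a connected graph `G` with `|V| ≥ 2` and distinguished
vertex `a` are adjacent iff `TB` is obtained from `TA` by deleting the unique edge of `TA`
incident to some leaf `v ≠ a` of `TA` and adding an edge of `G` joining `v` to some vertex. -/
theorem adjacent_iff_leaf_move {V : Type*} [Fintype V] (G : SimpleGraph V) (a : V)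
    (hn : 2 ≤ Fintype.card V) (hG : G.Connected)
    (TA TB : SimpleGraph V) (hTA : IsSpanningTree G TA) (hTB : IsSpanningTree G TB) :
    TreesAdjacent a TA TB ↔
      ∃ v u w : V, v ≠ a ∧ TA.neighborSet v = {u} ∧ G.Adj v w ∧
        TB.edgeSet = (TA.edgeSet \ {s(v, u)}) ∪ {s(v, w)} := by
  have : Nontrivial V := Fintype.one_lt_card_iff_nontrivial.1 hn
  constructor
  · rintro ⟨W, haW, hW, S, hS, hST⟩
    obtain ⟨v, hv⟩ : ∃ v, Wᶜ = {v} := by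
      rw [← Set.ncard_eq_one]
      have := Set.ncard_add_ncard_compl W
      rw [Nat.card_eq_fintype_card] at this
      omega
    obtain rfl : W = {v}ᶜ := by rw [← hv, compl_compl]
    have hA : S = TA.induce {v}ᶜ :=
      hS.eq_of_le_of_isAcyclic (hTA.2.isAcyclic.induce _) fun x y h => (hST x y h).1
    have hB : S = TB.induce {v}ᶜ :=
      hS.eq_of_le_of_isAcyclic (hTB.2.isAcyclic.induce _) fun x y h => (hST x y h).2
    obtain ⟨u, hu⟩ := hTA.2.exists_neighborSet_eq_singleton (hA ▸ hS.connected.preconnected)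
    obtain ⟨w, hw⟩ := hTB.2.exists_neighborSet_eq_singleton (hB ▸ hS.connected.preconnected)
    have hu' (x : V) : TA.Adj v x ↔ x = u := by
      rw [← SimpleGraph.mem_neighborSet, hu, Set.mem_singleton_iff]
    have hw' (x : V) : TB.Adj v x ↔ x = w := by
      rw [← SimpleGraph.mem_neighborSet, hw, Set.mem_singleton_iff]
    refine ⟨v, u, w, fun h => haW h.symm, hu, hTB.1 ((hw' w).2 rfl), ?_⟩
    ext e
    induction e with | _ x y
    simp only [SimpleGraph.mem_edgeSet, Set.mem_union, Set.mem_sdiff, Set.mem_singleton_iff,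
      Sym2.eq_iff]
    by_cases hx : x = v
    · subst hx
      grind
    by_cases hy : y = v
    · subst hy
      rw [TA.adj_comm, TB.adj_comm]
      grind
    have hxy : TA.Adj x y ↔ TB.Adj x y := by
      have := congrArg (fun H => H.Adj ⟨x, hx⟩ ⟨y, hy⟩) (hA.symm.trans hB)
      simpa using this
    grind
  · rintro ⟨v, u, w, hva, hu, -, hE⟩
    refine ⟨{v}ᶜ, hva.symm, ?_, TA.induce {v}ᶜ, ⟨?_, hTA.2.isAcyclic.induce _⟩, ?_⟩
    · rw [Set.ncard_compl, Set.ncard_singleton, Nat.card_eq_fintype_card]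
    · classical
      apply hTA.2.connected.induce_compl_singleton_of_degree_eq_one
      rw [← SimpleGraph.card_neighborSet_eq_degree, Fintype.card_eq_one_iff_nonempty_unique]
      rw [hu]
      exact ⟨inferInstance⟩
    · rintro ⟨x, hx⟩ ⟨y, hy⟩ h
      simp only [Set.mem_compl_iff, Set.mem_singleton_iff] at hx hy
      have hxy : TA.Adj x y := h
      refine ⟨hxy, ?_⟩
      rw [← SimpleGraph.mem_edgeSet, hE]
      simp [hxy, hx, hy]
end

section
/- Let G = (V,E) be a connected simple graph with n = |V| ≥ 2 vertices and a specified vertex a ∈ V, and let T_A and T_B be adjacent spanning trees of G. For any vertex v ∈ V, let s_T(v) denote the number of vertices u ∈ V such that v lies on the unique path in the spanning tree T from u to a (the size of the subtree rooted at v when T is rooted at a). Then for every v ∈ V, |s_{T_A}(v) − s_{T_B}(v)| ≤ 1. -/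
/-- The size of the subtree of the spanning tree `T` rooted at `v` (with respect to the root
`a`): the number of vertices `u` such that `v` lies on the unique path in `T` from `u` to `a`. -/
noncomputable def subtreeSize {V : Type*} (T : SimpleGraph V) (a v : V) : ℕ :=
  {u : V | ∀ p : T.Walk u a, p.IsPath → v ∈ p.support}.ncard

open SimpleGraph in
/-- A path inside a subgraph containing the root decides membership in a rooted subtree. -/
theorem mem_subtree_iff_mem_support {V : Type*} {T : SimpleGraph V} (hT : T.IsAcyclic) {W : Set V}
    {S : SimpleGraph W} (f : S →g T) (hf : ∀ x, f x = x) {u a : W} (v : V) (q : S.Walk u a)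
    (hq : q.IsPath) :
    (∀ p : T.Walk u a, p.IsPath → v ∈ p.support) ↔ v ∈ q.support.map Subtype.val := by
  have hfun : (f : W → V) = Subtype.val := funext hf
  have hinj : Function.Injective f := hfun ▸ Subtype.val_injective
  set r : T.Walk u a := (q.map f).copy (hf u) (hf a) with hr
  have hrp : r.IsPath := by
    simpa [hr] using Walk.IsPath.map hinj hq
  have hsupp : r.support = q.support.map Subtype.val := by
    simp [hr, Walk.support_map, hfun]
  rw [← hsupp]
  refine ⟨fun h => h r hrp, fun h p hp => ?_⟩
  have heq : p = r := congrArg Subtype.val ((hT.subsingleton_path _ _).elim ⟨p, hp⟩ ⟨r, hrp⟩)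
  exact heq ▸ h

/-- Sets that agree on the complement of at most one point have cardinalities differing by at
most one. -/
theorem abs_ncard_sub_ncard_le_one {V : Type*} [Finite V] {A B W : Set V} (hW : Wᶜ.ncard ≤ 1)
    (h : ∀ u ∈ W, u ∈ A ↔ u ∈ B) : |(A.ncard : ℤ) - (B.ncard : ℤ)| ≤ 1 := by
  have key : ∀ X Y : Set V, (∀ u ∈ W, u ∈ X → u ∈ Y) → X.ncard ≤ Y.ncard + 1 := by
    intro X Y hXY
    have hsub : X ⊆ Y ∪ Wᶜ := fun u hu => by
      by_cases huW : u ∈ W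
      · exact Or.inl (hXY u huW hu)
      · exact Or.inr huW
    have h1 := Set.ncard_le_ncard hsub
    have h2 := Set.ncard_union_le Y Wᶜ
    omega
  have h1 := key A B fun u hu => (h u hu).1
  have h2 := key B A fun u hu => (h u hu).2
  rw [abs_le]
  omega

/-- For adjacent spanning trees `TA`, `TB` of a connected graph `G` on at least two vertices,
the sizes of the subtrees rooted at any vertex `v` (with respect to the root `a`) differ by
at most one. -/
theorem adjacent_subtree_sizes {V : Type*} [Fintype V] (G : SimpleGraph V) (a : V)
    (hn : 2 ≤ Fintype.card V) (hG : G.Connected)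
    (TA TB : SimpleGraph V) (hTA : IsSpanningTree G TA) (hTB : IsSpanningTree G TB)
    (hadj : TreesAdjacent a TA TB) :
    ∀ v : V, |(subtreeSize TA a v : ℤ) - (subtreeSize TB a v : ℤ)| ≤ 1 := by
  intro v
  obtain ⟨W, haW, hW, S, hS, hadj⟩ := hadj
  have hcompl : Wᶜ.ncard ≤ 1 := by
    have h := Set.ncard_add_ncard_compl W
    rw [Nat.card_eq_fintype_card] at h
    omega
  refine abs_ncard_sub_ncard_le_one hcompl fun u hu => ?_
  obtain ⟨q, hq⟩ := hS.connected.exists_isPath ⟨u, hu⟩ ⟨a, haW⟩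
  exact (mem_subtree_iff_mem_support hTA.2.isAcyclic ⟨Subtype.val, fun h => (hadj _ _ h).1⟩
    (fun _ => rfl) v q hq).trans
    (mem_subtree_iff_mem_support hTB.2.isAcyclic ⟨Subtype.val, fun h => (hadj _ _ h).2⟩
    (fun _ => rfl) v q hq).symm
end

section
/- Let G = (V,E) be a 2-vertex-connected simple graph with n = |V| ≥ 2 vertices and a specified vertex a ∈ V. For any two spanning trees T and T' of G, there is a sequence of at most 4n² spanning trees of G beginning with T and ending with T', such that every pair of consecutive trees in the sequence are adjacent (adjacency meaning their edge-intersection contains a tree on n−1 vertices including a). -/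
/-- `G` is 2-vertex-connected: it has at least 3 vertices and deleting any single vertex
leaves a connected graph. -/
def TwoConnected {V : Type*} [Fintype V] (G : SimpleGraph V) : Prop :=
  3 ≤ Fintype.card V ∧ ∀ v : V, (G.induce {w | w ≠ v}).Connected

namespace SpanningTreeMoves

open SimpleGraph

variable {V : Type*}

/-- The graph joining every vertex `x ≠ a` to its parent `p x`. -/
def parentGraph (a : V) (p : V → V) : SimpleGraph V :=
  SimpleGraph.fromRel fun x y => x ≠ a ∧ p x = y

/-- Iterating `p` from any vertex eventually reaches `a`, as witnessed by a rank function. -/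
def IsRooted (a : V) (p : V → V) : Prop :=
  ∃ h : V → ℕ, ∀ x, x ≠ a → h (p x) < h x

theorem parentGraph_adj {a : V} {p : V → V} {x y : V} :
    (parentGraph a p).Adj x y ↔ x ≠ y ∧ ((x ≠ a ∧ p x = y) ∨ (y ≠ a ∧ p y = x)) :=
  SimpleGraph.fromRel_adj _ _ _

theorem parentGraph_congr {a : V} {p q : V → V} (h : ∀ x, x ≠ a → p x = q x) :
    parentGraph a p = parentGraph a q := by
  ext x y
  simp only [parentGraph_adj]
  grind

theorem IsRooted.congr {a : V} {p q : V → V} (hp : IsRooted a p)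
    (h : ∀ x, x ≠ a → p x = q x) : IsRooted a q := by
  obtain ⟨r, hr⟩ := hp
  exact ⟨r, fun x hx => h x hx ▸ hr x hx⟩

theorem IsRooted.adj {a : V} {p : V → V} (hp : IsRooted a p) {x : V} (hx : x ≠ a) :
    (parentGraph a p).Adj x (p x) := by
  obtain ⟨h, hh⟩ := hp
  refine parentGraph_adj.2 ⟨fun he => ?_, Or.inl ⟨hx, rfl⟩⟩
  have := hh x hx
  rw [← he] at this
  exact lt_irrefl _ this

theorem IsRooted.connected {a : V} {p : V → V} (hp : IsRooted a p) :
    (parentGraph a p).Connected := by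
  obtain ⟨h, hh⟩ := id hp
  have key : ∀ n x, h x = n → (parentGraph a p).Reachable x a := by
    intro n
    induction n using Nat.strong_induction_on with
    | _ n ih =>
      intro x hx
      by_cases hxa : x = a
      · rw [hxa]
      · exact (hp.adj hxa).reachable.trans (ih _ (hx ▸ hh x hxa) _ rfl)
  have : Nonempty V := ⟨a⟩
  exact ⟨fun x y => (key _ x rfl).trans (key _ y rfl).symm⟩

theorem IsRooted.isTree [Finite V] {a : V} {p : V → V} (hp : IsRooted a p) :
    (parentGraph a p).IsTree := by
  classical
  have := Fintype.ofFinite V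
  refine isTree_iff_connected_and_card.2 ⟨hp.connected, ?_⟩
  refine le_antisymm ?_ hp.connected.card_vert_le_card_edgeSet_add_one
  have hsub : (parentGraph a p).edgeSet ⊆ (fun x => s(x, p x)) '' {x | x ≠ a} := by
    intro e
    induction e with
    | _ x y =>
      intro he
      rw [mem_edgeSet, parentGraph_adj] at he
      obtain ⟨-, ⟨hx, rfl⟩ | ⟨hy, rfl⟩⟩ := he
      · exact ⟨x, hx, rfl⟩
      · exact ⟨y, hy, Sym2.eq_swap⟩
  have h1 : (parentGraph a p).edgeSet.ncard ≤ {x : V | x ≠ a}.ncard :=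
    (Set.ncard_le_ncard hsub (Set.toFinite _)).trans (Set.ncard_image_le (Set.toFinite _))
  have h2 : {x : V | x ≠ a}.ncard + 1 = Nat.card V := by
    have := Set.ncard_add_ncard_compl ({a} : Set V)
    rw [Set.ncard_singleton] at this
    rw [← this, add_comm]
    rfl
  rw [Nat.card_coe_set_eq]
  omega

/-- Every tree is the parent graph of a rooted parent function. -/
theorem exists_parentGraph_eq {T : SimpleGraph V} (hT : T.IsTree) (a : V) :
    ∃ p, IsRooted a p ∧ parentGraph a p = T := by
  have hex : ∀ x, ∃ y, x ≠ a → T.Adj x y ∧ T.dist y a < T.dist x a := by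
    intro x
    by_cases hx : x = a
    · exact ⟨a, fun h => absurd hx h⟩
    obtain ⟨w, hw⟩ := hT.connected.exists_walk_length_eq_dist x a
    cases w with
    | nil => exact absurd rfl hx
    | @cons _ y _ hxy w' =>
      refine ⟨y, fun _ => ⟨hxy, ?_⟩⟩
      have := dist_le w'
      rw [Walk.length_cons] at hw
      omega
  choose p hp using hex
  have hr : IsRooted a p := ⟨fun x => T.dist x a, fun x hx => (hp x hx).2⟩
  have hle : parentGraph a p ≤ T := by
    intro x y h
    obtain ⟨-, ⟨hx, rfl⟩ | ⟨hy, rfl⟩⟩ := parentGraph_adj.1 h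
    · exact (hp x hx).1
    · exact (hp y hy).1.symm
  exact ⟨p, hr, le_antisymm hle ((isTree_iff_minimal_connected.1 hT).2 hr.connected hle)⟩

theorem isSpanningTree_parentGraph [Finite V] {G : SimpleGraph V} {a : V} {p : V → V}
    (hp : IsRooted a p) (hG : ∀ x, x ≠ a → G.Adj x (p x)) :
    IsSpanningTree G (parentGraph a p) := by
  refine ⟨fun x y h => ?_, hp.isTree⟩
  obtain ⟨-, ⟨hx, rfl⟩ | ⟨hy, rfl⟩⟩ := parentGraph_adj.1 h
  · exact hG x hx
  · exact (hG y hy).symm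

/-- Changing the parent of a childless vertex keeps a parent function rooted. -/
theorem IsRooted.of_leaf {a v : V} {p q : V → V} (hp : IsRooted a p)
    (hleaf : ∀ x, x ≠ a → p x ≠ v) (heq : ∀ x, x ≠ a → x ≠ v → p x = q x) (hqv : q v ≠ v) :
    IsRooted a q := by
  classical
  obtain ⟨h, hh⟩ := hp
  refine ⟨Function.update h v (h (q v) + 1), fun x hx => ?_⟩
  by_cases hxv : x = v
  · subst hxv
    rw [Function.update_self, Function.update_of_ne hqv]
    omega
  · rw [Function.update_of_ne hxv, ← heq x hx hxv, Function.update_of_ne (hleaf x hx)]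
    exact hh x hx

/-- Changing the parent of a childless vertex yields an adjacent tree. -/
theorem treesAdjacent_of_leaf [Fintype V] {a v : V} {p q : V → V} (hp : IsRooted a p)
    (hva : v ≠ a) (hleaf : ∀ x, x ≠ a → p x ≠ v) (heq : ∀ x, x ≠ a → x ≠ v → p x = q x) :
    TreesAdjacent a (parentGraph a p) (parentGraph a q) := by
  classical
  let r : ({v}ᶜ : Set V) → ({v}ᶜ : Set V) := fun x =>
    if hx : p x = v then ⟨a, hva.symm⟩ else ⟨p x, hx⟩
  have hr : ∀ x : ({v}ᶜ : Set V), (x : V) ≠ a → (r x : V) = p x := by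
    intro x hx
    simp only [r, dif_neg (hleaf x hx)]
  let a' : ({v}ᶜ : Set V) := ⟨a, hva.symm⟩
  have hne : ∀ x : ({v}ᶜ : Set V), x ≠ a' → (x : V) ≠ a := fun x hx h => hx (Subtype.ext h)
  refine ⟨{v}ᶜ, hva.symm, ?_, parentGraph a' r, ?_, ?_⟩
  · rw [Set.ncard_compl, Set.ncard_singleton, Nat.card_eq_fintype_card]
  · obtain ⟨h, hh⟩ := hp
    refine IsRooted.isTree ⟨fun x => h x, fun x hx => ?_⟩
    beta_reduce
    rw [hr x (hne x hx)]
    exact hh x (hne x hx)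
  · intro x y hxy
    obtain ⟨hxy', h⟩ := parentGraph_adj.1 hxy
    have hxy' : (x : V) ≠ y := fun h => hxy' (Subtype.ext h)
    simp only [parentGraph_adj]
    rcases h with ⟨hx, h⟩ | ⟨hx, h⟩
    · have hp' := hr x (hne x hx)
      have hq := heq x (hne x hx) x.2
      rw [h] at hp'
      exact ⟨⟨hxy', .inl ⟨hne x hx, hp'.symm⟩⟩, hxy', .inl ⟨hne x hx, by rw [hp', hq]⟩⟩
    · have hp' := hr y (hne y hx)
      have hq := heq y (hne y hx) y.2
      rw [h] at hp'
      exact ⟨⟨hxy', .inr ⟨hne y hx, hp'.symm⟩⟩, hxy', .inr ⟨hne y hx, by rw [hp', hq]⟩⟩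

theorem TreesAdjacent.symm [Fintype V] {a : V} {T T' : SimpleGraph V}
    (h : TreesAdjacent a T T') : TreesAdjacent a T' T := by
  obtain ⟨W, ha, hc, S, hS, hadj⟩ := h
  exact ⟨W, ha, hc, S, hS, fun u v huv => (hadj u v huv).symm⟩

/-- The graph of spanning trees of `G`, two distinct ones being joined when they are adjacent. -/
def treeGraph [Fintype V] (G : SimpleGraph V) (a : V) : SimpleGraph (SimpleGraph V) where
  Adj T T' := T ≠ T' ∧ IsSpanningTree G T ∧ IsSpanningTree G T' ∧ TreesAdjacent a T T'
  symm := ⟨fun _ _ h => ⟨h.1.symm, h.2.2.1, h.2.1, TreesAdjacent.symm h.2.2.2⟩⟩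
  loopless := ⟨fun _ h => h.1 rfl⟩

/-- `T` and `T'` are at distance at most `k` in the graph of spanning trees. -/
def Within [Fintype V] (G : SimpleGraph V) (a : V) (k : ℕ) (T T' : SimpleGraph V) : Prop :=
  ∃ w : (treeGraph G a).Walk T T', w.length ≤ k

theorem Within.refl [Fintype V] {G : SimpleGraph V} {a : V} (k : ℕ) (T : SimpleGraph V) :
    Within G a k T T :=
  ⟨.nil, Nat.zero_le _⟩

theorem Within.symm [Fintype V] {G : SimpleGraph V} {a : V} {k : ℕ} {T T' : SimpleGraph V}
    (h : Within G a k T T') : Within G a k T' T := by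
  obtain ⟨w, hw⟩ := h
  exact ⟨w.reverse, by rwa [Walk.length_reverse]⟩

theorem Within.trans [Fintype V] {G : SimpleGraph V} {a : V} {k l : ℕ} {T T' T'' : SimpleGraph V}
    (h : Within G a k T T') (h' : Within G a l T' T'') : Within G a (k + l) T T'' := by
  obtain ⟨w, hw⟩ := h
  obtain ⟨w', hw'⟩ := h'
  exact ⟨w.append w', by rw [Walk.length_append]; omega⟩

theorem Within.mono [Fintype V] {G : SimpleGraph V} {a : V} {k l : ℕ} {T T' : SimpleGraph V}
    (h : Within G a k T T') (hkl : k ≤ l) : Within G a l T T' := by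
  obtain ⟨w, hw⟩ := h
  exact ⟨w, hw.trans hkl⟩

theorem within_one_of_leaf [Fintype V] {G : SimpleGraph V} {a v : V} {p q : V → V}
    (hp : IsRooted a p) (hpG : ∀ x, x ≠ a → G.Adj x (p x)) (hqG : ∀ x, x ≠ a → G.Adj x (q x))
    (hva : v ≠ a) (hleaf : ∀ x, x ≠ a → p x ≠ v) (heq : ∀ x, x ≠ a → x ≠ v → p x = q x) :
    IsRooted a q ∧ Within G a 1 (parentGraph a p) (parentGraph a q) := by
  have hq : IsRooted a q := hp.of_leaf hleaf heq (hqG v hva).ne'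
  refine ⟨hq, ?_⟩
  by_cases he : parentGraph a p = parentGraph a q
  · rw [he]
    exact Within.refl _ _
  · have hadj : (treeGraph G a).Adj (parentGraph a p) (parentGraph a q) :=
      ⟨he, isSpanningTree_parentGraph hp hpG, isSpanningTree_parentGraph hq hqG,
        treesAdjacent_of_leaf hp hva hleaf heq⟩
    exact ⟨hadj.toWalk, le_of_eq rfl⟩

/-- The parent function which is `p` on `R`, and off `R` is `high` on the vertices numbered at
least `i` and `low` on the others. -/
noncomputable def mixedParent (p low high : V → V) (ν : V → ℕ) (R : Set V) (i : ℕ) (x : V) : V :=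
  open Classical in if x ∈ R then p x else if i ≤ ν x then high x else low x

/-- `ν` is a numbering in which each vertex other than `a` has a neighbour `low x` with a smaller
number and a neighbour `high x` with a larger number, where `a` counts as both. -/
structure IsBipolar (G : SimpleGraph V) (a : V) (N : ℕ) (ν : V → ℕ) (low high : V → V) :
    Prop where
  lt : ∀ x, x ≠ a → ν x < N
  inj : ∀ x y, x ≠ a → y ≠ a → ν x = ν y → x = y
  low_adj : ∀ x, x ≠ a → G.Adj x (low x)
  high_adj : ∀ x, x ≠ a → G.Adj x (high x)
  low_lt : ∀ x, x ≠ a → low x ≠ a → ν (low x) < ν x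
  lt_high : ∀ x, x ≠ a → high x ≠ a → ν x < ν (high x)

section Moves

variable {G : SimpleGraph V} {a : V} {N : ℕ} {ν : V → ℕ} {p low high : V → V}
  {R : Set V}

theorem IsBipolar.mixedParent_adj (hν : IsBipolar G a N ν low high)
    (hpG : ∀ x, x ≠ a → G.Adj x (p x)) (i : ℕ) (x : V) (hx : x ≠ a) :
    G.Adj x (mixedParent p low high ν R i x) := by
  unfold mixedParent
  split_ifs
  · exact hpG x hx
  · exact hν.high_adj x hx
  · exact hν.low_adj x hx

theorem IsBipolar.mixedParent_ne (hν : IsBipolar G a N ν low high) {v : V} (hva : v ≠ a)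
    (hR : ∀ x ∈ R, p x ≠ v) {j : ℕ} (h1 : ν v ≤ j) (h2 : j ≤ ν v + 1) (x : V) (hx : x ≠ a) :
    mixedParent p low high ν R j x ≠ v := by
  unfold mixedParent
  split_ifs with hxR hj
  · exact hR x hxR
  · rintro rfl
    have := hν.lt_high x hx hva
    omega
  · rintro rfl
    have := hν.low_lt x hx hva
    omega

variable [Fintype V]

theorem IsBipolar.mixedParent_succ (hν : IsBipolar G a N ν low high)
    (hpG : ∀ x, x ≠ a → G.Adj x (p x)) (hR : ∀ x ∈ R, p x ∈ R ∨ p x = a) (i : ℕ) :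
    (IsRooted a (mixedParent p low high ν R i) ↔ IsRooted a (mixedParent p low high ν R (i + 1))) ∧
    (IsRooted a (mixedParent p low high ν R i) →
      Within G a 1 (parentGraph a (mixedParent p low high ν R i))
        (parentGraph a (mixedParent p low high ν R (i + 1)))) := by
  by_cases hex : ∃ v, v ≠ a ∧ v ∉ R ∧ ν v = i
  · obtain ⟨v, hva, hvR, rfl⟩ := hex
    have hRv : ∀ x ∈ R, p x ≠ v := by
      rintro x hx rfl
      exact (hR x hx).elim hvR hva
    have heq : ∀ x, x ≠ a → x ≠ v →
        mixedParent p low high ν R (ν v) x = mixedParent p low high ν R (ν v + 1) x := by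
      intro x hx hxv
      have : ν x ≠ ν v := fun h => hxv (hν.inj x v hx hva h)
      have : ν v ≤ ν x ↔ ν v + 1 ≤ ν x := by omega
      simp only [mixedParent, this]
    have l1 := hν.mixedParent_ne hva hRv le_rfl (Nat.le_succ _)
    have l2 := hν.mixedParent_ne hva hRv (Nat.le_succ _) le_rfl
    refine ⟨⟨fun h => ?_, fun h => ?_⟩, fun h => ?_⟩
    · exact (within_one_of_leaf h (hν.mixedParent_adj hpG _) (hν.mixedParent_adj hpG _) hva l1
        heq).1
    · exact (within_one_of_leaf h (hν.mixedParent_adj hpG _) (hν.mixedParent_adj hpG _) hva l2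
        fun x hx hxv => (heq x hx hxv).symm).1
    · exact (within_one_of_leaf h (hν.mixedParent_adj hpG _) (hν.mixedParent_adj hpG _) hva l1
        heq).2
  · have heq : ∀ x, x ≠ a →
        mixedParent p low high ν R i x = mixedParent p low high ν R (i + 1) x := by
      intro x hx
      unfold mixedParent
      split_ifs with hxR h1 h2 h2
      · rfl
      · rfl
      · exact absurd ⟨x, hx, hxR, by omega⟩ hex
      · omega
      · rfl
    refine ⟨⟨fun h => h.congr heq, fun h => h.congr fun x hx => (heq x hx).symm⟩, fun _ => ?_⟩
    rw [parentGraph_congr heq]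
    exact Within.refl _ _

theorem IsBipolar.mixedParent_zero (hν : IsBipolar G a N ν low high)
    (hpG : ∀ x, x ≠ a → G.Adj x (p x)) (hR : ∀ x ∈ R, p x ∈ R ∨ p x = a) (i : ℕ) :
    (IsRooted a (mixedParent p low high ν R 0) ↔ IsRooted a (mixedParent p low high ν R i)) ∧
    (IsRooted a (mixedParent p low high ν R 0) →
      Within G a i (parentGraph a (mixedParent p low high ν R 0))
        (parentGraph a (mixedParent p low high ν R i))) := by
  induction i with
  | zero => exact ⟨Iff.rfl, fun _ => Within.refl _ _⟩
  | succ i ih =>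
    obtain ⟨h1, h2⟩ := hν.mixedParent_succ hpG hR i
    exact ⟨ih.1.trans h1, fun h => (ih.2 h).trans (h2 (ih.1.1 h))⟩

theorem IsBipolar.within_mixedParent (hν : IsBipolar G a N ν low high)
    (hp : IsRooted a p) (hpG : ∀ x, x ≠ a → G.Adj x (p x)) (m : ℕ) (R : Set V) (haR : a ∉ R)
    (hR : ∀ x ∈ R, p x ∈ R ∨ p x = a) (hm : R.ncard = m)
    (hr : IsRooted a (mixedParent p low high ν R 0)) :
    Within G a (m * (2 * N + 1)) (parentGraph a (mixedParent p low high ν R 0))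
      (parentGraph a high) := by
  induction m generalizing R with
  | zero =>
    rw [Set.ncard_eq_zero] at hm
    subst hm
    have : mixedParent p low high ν ∅ 0 = high := by
      ext x
      simp [mixedParent]
    rw [this]
    exact Within.refl _ _
  | succ m ih =>
    obtain ⟨h, hh⟩ := id hp
    have hne : R.Nonempty := by
      rw [← Set.ncard_pos]
      omega
    obtain ⟨v, hvR, hmax⟩ := Set.exists_max_image R h (Set.toFinite R) hne
    have hva : v ≠ a := fun he => haR (he ▸ hvR)
    have hRv : ∀ x ∈ R, p x ≠ v := by
      rintro x hx rfl
      exact absurd (hh x fun he => haR (he ▸ hx)) (not_lt.2 (hmax x hx))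
    have hR' : ∀ x ∈ R \ {v}, p x ∈ R \ {v} ∨ p x = a := fun x hx =>
      (hR x hx.1).imp_left fun h => ⟨h, hRv x hx.1⟩
    have hcard : (R \ {v}).ncard = m := by
      rw [Set.ncard_sdiff_singleton_of_mem hvR, hm]
      rfl
    obtain ⟨e1, w1⟩ := hν.mixedParent_zero hpG hR (ν v + 1)
    have w1 := w1 hr
    have hr1 := e1.1 hr
    obtain ⟨hr2, w2⟩ := within_one_of_leaf (q := mixedParent p low high ν (R \ {v}) (ν v + 1)) hr1
      (hν.mixedParent_adj hpG _) (hν.mixedParent_adj hpG _) hva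
      (hν.mixedParent_ne hva hRv (Nat.le_succ _) le_rfl) (by
        intro x _ hxv
        by_cases hxR : x ∈ R
        · have hxR' : x ∈ R \ {v} := ⟨hxR, hxv⟩
          simp only [mixedParent, if_pos hxR, if_pos hxR']
        · have hxR' : x ∉ R \ {v} := fun h => hxR h.1
          simp only [mixedParent, if_neg hxR, if_neg hxR'])
    obtain ⟨e3, w3⟩ := hν.mixedParent_zero hpG hR' (ν v + 1)
    have hr3 := e3.2 hr2
    have w3 := (w3 hr3).symm
    refine (((w1.trans w2).trans w3).trans (ih _ (fun h => haR h.1) hR' hcard hr3)).mono ?_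
    have := hν.lt v hva
    rw [add_mul, one_mul, add_comm (m * (2 * N + 1))]
    exact Nat.add_le_add_right (by omega) _

theorem IsBipolar.within_parentGraph_high (hν : IsBipolar G a N ν low high)
    (hp : IsRooted a p) (hpG : ∀ x, x ≠ a → G.Adj x (p x)) :
    Within G a ((Fintype.card V - 1) * (2 * N + 1)) (parentGraph a p) (parentGraph a high) := by
  have heq : ∀ x, x ≠ a → p x = mixedParent p low high ν {a}ᶜ 0 x := by
    intro x hx
    simp [mixedParent, hx]
  rw [parentGraph_congr heq]
  refine hν.within_mixedParent hp hpG _ _ (by simp) (fun x _ => ?_) ?_ (hp.congr heq)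
  · exact (em (p x = a)).symm
  · rw [Set.ncard_compl, Set.ncard_singleton, Nat.card_eq_fintype_card]

end Moves

/-- Each vertex of the list `L` has a neighbour that is in `A` or precedes it in `L`, and a
neighbour that is in `Z` or follows it in `L`. -/
def IsSplit (G : SimpleGraph V) : Set V → List V → Set V → Prop
  | _, [], _ => True
  | A, x :: L, Z => (∃ y ∈ A, G.Adj x y) ∧ (∃ z, (z ∈ L ∨ z ∈ Z) ∧ G.Adj x z) ∧
      IsSplit G (insert x A) L Z

section Ordering

variable {G : SimpleGraph V} {a : V}

theorem IsSplit.mono {A A' Z Z' : Set V} {L : List V} (h : IsSplit G A L Z) (hA : A ⊆ A')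
    (hZ : Z ⊆ Z') : IsSplit G A' L Z' := by
  induction L generalizing A A' with
  | nil => trivial
  | cons x L ih =>
    obtain ⟨⟨y, hy, hxy⟩, ⟨z, hz, hxz⟩, h⟩ := h
    exact ⟨⟨y, hA hy, hxy⟩, ⟨z, hz.imp_right fun h => hZ h, hxz⟩,
      ih h (Set.insert_subset_insert hA)⟩

theorem isSplit_append {A Z : Set V} {L M : List V} :
    IsSplit G A (L ++ M) Z ↔
      IsSplit G A L ({x | x ∈ M} ∪ Z) ∧ IsSplit G ({x | x ∈ L} ∪ A) M Z := by
  induction L generalizing A with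
  | nil => simp [IsSplit]
  | cons x L ih =>
    have : ({y | y ∈ x :: L} ∪ A : Set V) = {y | y ∈ L} ∪ insert x A := by
      ext y
      simp only [List.mem_cons, Set.mem_union, Set.mem_ofPred_eq, Set.mem_insert_iff]
      tauto
    rw [this]
    simp only [List.cons_append, IsSplit, ih, List.mem_append, Set.mem_union, Set.mem_ofPred_eq,
      or_assoc, and_assoc]

theorem IsSplit.reverse {A Z : Set V} {L : List V} (h : IsSplit G A L Z) :
    IsSplit G Z L.reverse A := by
  induction L generalizing A with
  | nil => trivial
  | cons x L ih =>
    obtain ⟨⟨y, hy, hxy⟩, ⟨z, hz, hxz⟩, h⟩ := h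
    rw [List.reverse_cons, isSplit_append]
    refine ⟨(ih h).mono le_rfl ?_, ⟨z, ?_, hxz⟩, ⟨y, .inr hy, hxy⟩, trivial⟩
    · rintro w (rfl | hw)
      · exact .inl (by simp)
      · exact .inr hw
    · exact hz.imp_left fun h => by simpa using h

theorem IsSplit.insert_after {A B P : List V} {s t : V} (h : IsSplit G {a} (A ++ s :: B) {a})
    (hP : IsSplit G {s} P {t}) (ht : t ∈ B ∨ t = a) :
    IsSplit G {a} (A ++ s :: (P ++ B)) {a} := by
  obtain ⟨hA, hs, ⟨z, hz, hsz⟩, hB⟩ := isSplit_append.1 h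
  refine isSplit_append.2 ⟨hA.mono le_rfl ?_, hs, ⟨z, ?_, hsz⟩, isSplit_append.2 ⟨?_, ?_⟩⟩
  · intro x hx
    simp only [List.mem_cons, Set.mem_union, Set.mem_ofPred_eq, List.mem_append] at hx ⊢
    tauto
  · rw [List.mem_append]
    tauto
  · refine hP.mono (by simp) ?_
    rintro _ rfl
    exact ht
  · exact hB.mono Set.subset_union_right le_rfl

/-- A path that leaves the complement of `S` contains a chain up to its first vertex in `S`. -/
theorem exists_isSplit_of_isPath {S : Set V} {x t : V} (w : G.Walk x t) (hw : w.IsPath)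
    (hx : x ∉ S) (ht : t ∈ S) :
    ∃ P : List V, P.Nodup ∧ x ∈ P ∧ (∀ y ∈ P, y ∈ w.support ∧ y ∉ S) ∧
      ∃ t' ∈ S, t' ∈ w.support ∧ ∀ s, G.Adj x s → IsSplit G {s} P {t'} := by
  induction w with
  | nil => exact absurd ht hx
  | @cons x y t hxy w ih =>
    rw [Walk.cons_isPath_iff] at hw
    by_cases hy : y ∈ S
    · exact ⟨[x], by simp, by simp, by simpa using hx, y, hy, by simp,
        fun s hs => ⟨⟨s, rfl, hs⟩, ⟨y, .inr rfl, hxy⟩, trivial⟩⟩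
    · obtain ⟨P, hP, hyP, hPS, t', ht'S, ht'w, hsplit⟩ := ih hw.1 hy ht
      refine ⟨x :: P, List.nodup_cons.2 ⟨fun h => hw.2 (hPS x h).1, hP⟩, by simp, ?_, t', ht'S,
        by simp [ht'w], fun s hs => ⟨⟨s, rfl, hs⟩, ⟨y, .inl hyP, hxy⟩, ?_⟩⟩
      · intro z hz
        rcases List.mem_cons.1 hz with rfl | hz
        · exact ⟨by simp, hx⟩
        · exact ⟨by simp [(hPS z hz).1], (hPS z hz).2⟩
      · exact (hsplit x hxy.symm).mono (by simp) le_rfl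

theorem exists_isPath_notMem_support {s x t : V} (h : (G.induce {w | w ≠ s}).Connected)
    (hx : x ≠ s) (ht : t ≠ s) : ∃ w : G.Walk x t, w.IsPath ∧ s ∉ w.support := by
  obtain ⟨w, hw⟩ := h.exists_isPath ⟨x, hx⟩ ⟨t, ht⟩
  let f : G.induce {w | w ≠ s} →g G := (Embedding.induce {w | w ≠ s}).toHom
  refine ⟨w.map f, hw.map Subtype.val_injective, fun hs => ?_⟩
  replace hs : s ∈ (w.map f).support := hs
  rw [Walk.support_map, List.mem_map] at hs
  obtain ⟨y, -, hy⟩ := hs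
  exact y.2 hy

theorem IsSplit.exists_longer (hG : G.Connected)
    (h2 : ∀ v : V, (G.induce {w | w ≠ v}).Connected) {L : List V} (hL : IsSplit G {a} L {a})
    (hnd : (a :: L).Nodup) {u : V} (hu : u ∉ a :: L) :
    ∃ L', IsSplit G {a} L' {a} ∧ (a :: L').Nodup ∧ L.length < L'.length := by
  obtain ⟨w⟩ := hG a u
  obtain ⟨⟨⟨s, x⟩, hsx⟩, -, hs, hx⟩ := w.exists_boundary_dart {y | y ∈ a :: L} (by simp) hu
  simp only [Set.mem_ofPred_eq] at hs hx hsx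
  by_cases hsa : s = a
  · subst hsa
    refine ⟨x :: L, ⟨⟨s, rfl, hsx.symm⟩, ⟨s, .inr rfl, hsx.symm⟩, hL.mono (by simp) le_rfl⟩, ?_,
      by simp⟩
    simp only [List.nodup_cons, List.mem_cons] at hnd hx ⊢
    grind
  · obtain ⟨w, hw, hsw⟩ := exists_isPath_notMem_support (h2 s) (x := x) (t := a)
      (fun h => hx (h ▸ hs)) (Ne.symm hsa)
    obtain ⟨P, hP, hxP, hPS, t, htS, htw, hsplit⟩ :=
      exists_isSplit_of_isPath (S := {y | y ∈ a :: L}) w hw hx (by simp)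
    have hts : t ≠ s := fun h => hsw (h ▸ htw)
    obtain ⟨A, B, rfl⟩ := List.append_of_mem ((List.mem_cons.1 hs).resolve_left hsa)
    have hPlen : 0 < P.length := List.length_pos_of_mem hxP
    have hPS' : ∀ y ∈ P, y ∉ a :: (A ++ s :: B) := fun y hy => (hPS y hy).2
    by_cases htA : t ∈ A
    · have hL' := hL.reverse
      rw [List.reverse_append, List.reverse_cons, List.append_assoc, List.singleton_append] at hL'
      refine ⟨_, hL'.insert_after (hsplit s hsx.symm) (.inl (by simpa using htA)), ?_, ?_⟩
      · have : (P ++ (a :: (A ++ s :: B))).Nodup :=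
          List.nodup_append'.2 ⟨hP, hnd, hPS'⟩
        refine (List.Perm.nodup_iff ?_).1 this
        rw [← Multiset.coe_eq_coe]
        simp only [← Multiset.coe_add, ← Multiset.cons_coe, Multiset.coe_reverse]
        simp only [← Multiset.singleton_add]
        abel
      · simp only [List.length_append, List.length_cons, List.length_reverse]
        omega
    · have htB : t ∈ B ∨ t = a := by
        simp only [Set.mem_ofPred_eq, List.mem_cons, List.mem_append] at htS
        tauto
      refine ⟨_, hL.insert_after (hsplit s hsx.symm) htB, ?_, ?_⟩
      · have : (P ++ (a :: (A ++ s :: B))).Nodup :=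
          List.nodup_append'.2 ⟨hP, hnd, hPS'⟩
        refine (List.Perm.nodup_iff ?_).1 this
        rw [← Multiset.coe_eq_coe]
        simp only [← Multiset.coe_add, ← Multiset.cons_coe]
        simp only [← Multiset.singleton_add]
        abel
      · simp only [List.length_append, List.length_cons]
        omega

theorem exists_isSplit [Fintype V] (hG : G.Connected)
    (h2 : ∀ v : V, (G.induce {w | w ≠ v}).Connected) (a : V) :
    ∃ L, IsSplit G {a} L {a} ∧ (a :: L).Nodup ∧ ∀ u, u ∈ a :: L := by
  by_contra! hcon
  have key : ∀ k, ∃ L, IsSplit G {a} L {a} ∧ (a :: L).Nodup ∧ k ≤ L.length := by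
    intro k
    induction k with
    | zero => exact ⟨[], trivial, by simp, le_rfl⟩
    | succ k ih =>
      obtain ⟨L, hL, hnd, hk⟩ := ih
      obtain ⟨u, hu⟩ := hcon L hL hnd
      obtain ⟨L', hL', hnd', hlt⟩ := hL.exists_longer hG h2 hnd hu
      exact ⟨L', hL', hnd', by omega⟩
  obtain ⟨L, -, hnd, hk⟩ := key (Fintype.card V)
  have := hnd.length_le_card
  rw [List.length_cons] at this
  omega

theorem exists_isBipolar [Fintype V] (hG : G.Connected)
    (h2 : ∀ v : V, (G.induce {w | w ≠ v}).Connected) (a : V) :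
    ∃ ν low high, IsBipolar G a (Fintype.card V - 1) ν low high := by
  classical
  obtain ⟨L, hL, hnd, hall⟩ := exists_isSplit hG h2 a
  have hmem : ∀ x, x ≠ a → x ∈ L := fun x hx => (List.mem_cons.1 (hall x)).resolve_left hx
  have hex : ∀ x, ∃ y z, x ≠ a → G.Adj x y ∧ G.Adj x z ∧ (y ≠ a → L.idxOf y < L.idxOf x) ∧
      (z ≠ a → L.idxOf x < L.idxOf z) := by
    intro x
    by_cases hx : x = a
    · exact ⟨a, a, fun h => absurd hx h⟩
    obtain ⟨A, B, rfl⟩ := List.append_of_mem (hmem x hx)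
    obtain ⟨-, ⟨y, hy, hxy⟩, ⟨z, hz, hxz⟩, -⟩ := isSplit_append.1 hL
    refine ⟨y, z, fun _ => ⟨hxy, hxz, fun hya => ?_, fun hza => ?_⟩⟩
    · have hyA : y ∈ A := hy.resolve_right hya
      grind
    · have hzB : z ∈ B := hz.resolve_right hza
      grind
  choose low high h using hex
  have hlen := hnd.length_le_card
  rw [List.length_cons] at hlen
  refine ⟨fun x => L.idxOf x, low, high, fun x hx => ?_, fun x y hx hy hxy => ?_,
    fun x hx => (h x hx).1, fun x hx => (h x hx).2.1, fun x hx => (h x hx).2.2.1,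
    fun x hx => (h x hx).2.2.2⟩
  · have := List.idxOf_lt_length_of_mem (hmem x hx)
    omega
  · exact (List.idxOf_inj (hmem x hx)).1 hxy

end Ordering

end SpanningTreeMoves

/-- For any two spanning trees `T`, `T'` of a 2-vertex-connected graph `G` on `n ≥ 2` vertices
with distinguished vertex `a`, there is a sequence of at most `4 n ^ 2` spanning trees starting
at `T` and ending at `T'` in which every pair of consecutive trees are adjacent. -/
theorem spanning_trees_connected_quadratic {V : Type*} [Fintype V] (G : SimpleGraph V) (a : V)
    (hn : 2 ≤ Fintype.card V) (h2 : TwoConnected G)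
    (T T' : SimpleGraph V) (hT : IsSpanningTree G T) (hT' : IsSpanningTree G T') :
    ∃ ℓ : ℕ, ∃ f : Fin (ℓ + 1) → SimpleGraph V,
      ℓ + 1 ≤ 4 * Fintype.card V ^ 2 ∧
      f 0 = T ∧ f (Fin.last ℓ) = T' ∧
      (∀ i, IsSpanningTree G (f i)) ∧
      (∀ i : Fin ℓ, TreesAdjacent a (f i.castSucc) (f i.succ)) := by
  have hG : G.Connected := hT.2.connected.mono hT.1
  obtain ⟨ν, low, high, hν⟩ := SpanningTreeMoves.exists_isBipolar hG h2.2 a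
  obtain ⟨p, hp, rfl⟩ := SpanningTreeMoves.exists_parentGraph_eq hT.2 a
  obtain ⟨p', hp', rfl⟩ := SpanningTreeMoves.exists_parentGraph_eq hT'.2 a
  obtain ⟨w, hw⟩ := (hν.within_parentGraph_high hp fun x hx => hT.1 (hp.adj hx)).trans
    (hν.within_parentGraph_high hp' fun x hx => hT'.1 (hp'.adj hx)).symm
  refine ⟨w.length, fun i => w.getVert i, ?_, by simp, by simp, fun i => ?_, fun i => ?_⟩
  · obtain ⟨m, hm⟩ := Nat.exists_eq_add_of_le' hn
    rw [hm] at hw ⊢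
    have : m + 2 - 1 = m + 1 := rfl
    rw [this] at hw
    nlinarith
  · by_cases hi : (i : ℕ) < w.length
    · exact (w.adj_getVert_succ hi).2.1
    · have : (i : ℕ) = w.length := by omega
      simpa only [this, SimpleGraph.Walk.getVert_length] using hT'
  · exact (w.adj_getVert_succ i.2).2.2.2
end

section
/- Let G = (V,E) be a 2-vertex-connected simple graph with n = |V| ≥ 2 vertices, let v_1, …, v_n be an st-numbering of G with v_1 = a, and let T' be a spanning tree of G. Let S be a subtree of T' containing a with vertex set V(S) ⊊ V, let (u*, v*) be an edge of T' with u* ∈ V(S), v* ∉ V(S), and with v* highest-numbered among all such edges of T', and let S' be the subtree of T' on V(S) ∪ {v*}. Suppose T is a spanning tree of G containing S in which every vertex outside V(S) except v_n is joined to its highest-numbered neighbor (and v_n, if outside V(S), is joined to v_1), and define T̃ analogously from S'. Then there is a sequence of at most 2n spanning trees of G beginning with T and ending with T̃ such that every pair of consecutive trees are adjacent (with respect to the distinguished vertex a). -/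
/-- The graph joining every vertex to its image under the parent map `p`. -/
def parentGraph {V : Type*} (p : V → V) : SimpleGraph V :=
  SimpleGraph.fromRel fun u v => p u = v

/-- `p` is a parent map rooted at `a`, with `r` strictly decreasing towards the root. -/
def IsRanked {V : Type*} (a : V) (p : V → V) (r : V → ℕ) : Prop :=
  p a = a ∧ ∀ v, v ≠ a → r (p v) < r v

theorem parentGraph_adj {V : Type*} {p : V → V} {u v : V} :
    (parentGraph p).Adj u v ↔ u ≠ v ∧ (p u = v ∨ p v = u) :=
  SimpleGraph.fromRel_adj _ _ _

theorem parentGraph_le {V : Type*} {a : V} {p : V → V} {r : V → ℕ} (h : IsRanked a p r)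
    {H : SimpleGraph V} (hH : ∀ v, v ≠ a → H.Adj v (p v)) : parentGraph p ≤ H := by
  intro u v huv
  rw [parentGraph_adj] at huv
  obtain ⟨hne, rfl | rfl⟩ := huv
  · exact hH u fun hu => hne (by rw [hu, h.1])
  · exact (hH v fun hv => hne (by rw [hv, h.1])).symm

theorem IsRanked.connected {V : Type*} {a : V} {p : V → V} {r : V → ℕ}
    (h : IsRanked a p r) : (parentGraph p).Connected := by
  have key : ∀ n v, r v = n → (parentGraph p).Reachable v a := by
    intro n
    induction n using Nat.strong_induction_on with
    | _ n ih =>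
      rintro v rfl
      by_cases hv : v = a
      · rw [hv]
      · have hlt := h.2 v hv
        have hadj : (parentGraph p).Adj v (p v) :=
          parentGraph_adj.2 ⟨fun hp => by rw [← hp] at hlt; exact hlt.false, .inl rfl⟩
        exact hadj.reachable.trans (ih _ hlt _ rfl)
  have : Nonempty V := ⟨a⟩
  exact ⟨fun u v => (key _ u rfl).trans (key _ v rfl).symm⟩

theorem IsRanked.isTree {V : Type*} [Finite V] {a : V} {p : V → V} {r : V → ℕ}
    (h : IsRanked a p r) : (parentGraph p).IsTree := by
  classical
  have := Fintype.ofFinite V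
  refine SimpleGraph.isTree_iff_connected_and_card.2
    ⟨h.connected, le_antisymm ?_ h.connected.card_vert_le_card_edgeSet_add_one⟩
  have hsub : (parentGraph p).edgeSet ⊆
      ((Finset.univ.erase a).image fun v => s(v, p v) : Finset (Sym2 V)) := by
    intro e
    induction e using Sym2.ind with
    | _ u v =>
      rw [SimpleGraph.mem_edgeSet, parentGraph_adj]
      rintro ⟨hne, rfl | rfl⟩
      · simp only [Finset.coe_image, Set.mem_image, Finset.mem_coe, Finset.mem_erase]
        exact ⟨u, ⟨fun hu => hne (by rw [hu, h.1]), Finset.mem_univ _⟩, rfl⟩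
      · simp only [Finset.coe_image, Set.mem_image, Finset.mem_coe, Finset.mem_erase]
        exact ⟨v, ⟨fun hv => hne (by rw [hv, h.1]), Finset.mem_univ _⟩, Sym2.eq_swap⟩
  have hcard := Set.ncard_le_ncard hsub (Finset.finite_toSet _)
  rw [Set.ncard_coe_finset] at hcard
  have himg := Finset.card_image_le (s := Finset.univ.erase a) (f := fun v => s(v, p v))
  have herase := Finset.card_erase_add_one (Finset.mem_univ a)
  rw [Finset.card_univ] at herase
  rw [Nat.card_eq_fintype_card (α := V), Nat.card_coe_set_eq]
  omega

theorem IsRanked.eq_of_isTree {V : Type*} {a : V} {p : V → V} {r : V → ℕ}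
    (h : IsRanked a p r) {T : SimpleGraph V} (hT : T.IsTree)
    (hadj : ∀ v, v ≠ a → T.Adj v (p v)) : parentGraph p = T :=
  le_antisymm (parentGraph_le h hadj)
    ((SimpleGraph.isTree_iff_minimal_connected.1 hT).2 h.connected (parentGraph_le h hadj))

theorem TreesAdjacent.symm {V : Type*} [Fintype V] {a : V} {A B : SimpleGraph V}
    (h : TreesAdjacent a A B) : TreesAdjacent a B A := by
  obtain ⟨W, haW, hW, S, hS, hadj⟩ := h
  exact ⟨W, haW, hW, S, hS, fun u v huv => (hadj u v huv).symm⟩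

/-- Moving a leaf `s` of a rooted tree to another parent yields an adjacent tree. -/
theorem treesAdjacent_of_eqOn_compl {V : Type*} [Fintype V] {a s : V} {p q : V → V} {r : V → ℕ}
    (h : IsRanked a p r) (hs : s ≠ a) (hleaf : ∀ u, u ≠ s → p u ≠ s)
    (hpq : ∀ u, u ≠ s → p u = q u) : TreesAdjacent a (parentGraph p) (parentGraph q) := by
  classical
  let p' : ({s}ᶜ : Set V) → ({s}ᶜ : Set V) := fun u => ⟨p u, hleaf u u.2⟩
  have hp' : IsRanked (⟨a, hs.symm⟩ : ({s}ᶜ : Set V)) p' fun u => r u :=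
    ⟨Subtype.ext h.1, fun v hv => h.2 v fun hva => hv (Subtype.ext hva)⟩
  refine ⟨{s}ᶜ, hs.symm, ?_, parentGraph p', hp'.isTree, ?_⟩
  · rw [Set.ncard_compl, Set.ncard_singleton, Nat.card_eq_fintype_card]
  · intro u v huv
    rw [parentGraph_adj] at huv
    rw [parentGraph_adj, parentGraph_adj, ← hpq u u.2, ← hpq v v.2]
    have hne : (u : V) ≠ v := fun he => huv.1 (Subtype.ext he)
    have hor : p u = v ∨ p v = u := huv.2.imp (congrArg Subtype.val) (congrArg Subtype.val)
    exact ⟨⟨hne, hor⟩, hne, hor⟩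

theorem IsRanked.treesAdjacent_self {V : Type*} [Fintype V] [Nontrivial V] {a : V} {p : V → V}
    {r : V → ℕ} (h : IsRanked a p r) : TreesAdjacent a (parentGraph p) (parentGraph p) := by
  obtain ⟨v, hv⟩ := exists_ne a
  obtain ⟨s, hsa, hs⟩ := (Set.toFinite {a}ᶜ).exists_maximalFor r _ ⟨v, hv⟩
  refine treesAdjacent_of_eqOn_compl h hsa (fun u hu hpu => ?_) fun _ _ => rfl
  by_cases hua : u = a
  · exact hsa (by rw [← hpu, hua, h.1]; rfl)
  · have := h.2 u hua
    rw [hpu] at this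
    exact this.not_ge (hs hua this.le)

/-- A rooted subtree containing `a` has a parent map decreasing the distance to `a`. -/
theorem exists_parent_of_connected_induce {V : Type*} [Finite V] {T : SimpleGraph V} {W : Set V}
    {a : V} (haW : a ∈ W) (hW : (T.induce W).Connected) :
    ∃ (p : V → V) (r : V → ℕ) (D : ℕ), p a = a ∧ (∀ v, r v ≤ D) ∧
      ∀ v ∈ W, p v ∈ W ∧ (v ≠ a → T.Adj v (p v) ∧ r (p v) < r v) := by
  classical
  let r : V → ℕ := fun v => if hv : v ∈ W then (T.induce W).dist ⟨v, hv⟩ ⟨a, haW⟩ else 0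
  have key : ∀ v, ∃ w, (v = a → w = a) ∧
      (v ∈ W → w ∈ W ∧ (v ≠ a → T.Adj v w ∧ r w < r v)) := by
    intro v
    by_cases hva : v = a
    · exact ⟨a, fun _ => rfl, fun _ => ⟨haW, fun h => absurd hva h⟩⟩
    by_cases hv : v ∈ W
    · obtain ⟨c, hc⟩ := hW.exists_walk_length_eq_dist ⟨v, hv⟩ ⟨a, haW⟩
      cases c with
      | nil => exact absurd rfl hva
      | @cons _ w _ hadj c' =>
        refine ⟨w, fun h => absurd h hva, fun _ => ⟨w.2, fun _ => ⟨hadj, ?_⟩⟩⟩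
        have hle := SimpleGraph.dist_le c'
        rw [SimpleGraph.Walk.length_cons] at hc
        simp only [r, dif_pos hv, dif_pos w.2]
        exact hle.trans_lt (by omega)
    · exact ⟨v, fun h => absurd h hva, fun h => absurd h hv⟩
  choose p hpa hp using key
  have : Nonempty V := ⟨a⟩
  obtain ⟨s, hs⟩ := Finite.exists_max r
  exact ⟨p, r, r s, hpa a rfl, hs, hp⟩

open Classical in
/-- The parent map equal to `p` on `W`, sending `s ∉ W` to `x`, and sending the remaining vertices
to `low` or `high` according to whether their index is below the threshold `j`. -/
noncomputable def hybridParent {V : Type*} (W : Set V) (idx : V → ℕ) (p low high : V → V)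
    (s x : V) (j : ℕ) (v : V) : V :=
  if v ∈ W then p v else if v = s then x else if idx v < j then low v else high v

/-- The data from which hybrid parent maps are built: a rooted subtree on `W`, and for every
vertex outside `W` a neighbor of lower index, and one which is either of higher index or the
root. -/
structure IsHybridData {V : Type*} (G : SimpleGraph V) (a : V) (W : Set V) (idx : V → ℕ)
    (p low high : V → V) (r : V → ℕ) (D N : ℕ) : Prop where
  root_mem : a ∈ W
  parent_root : p a = a
  rank_le : ∀ v, r v ≤ D
  idx_lt : ∀ v, idx v < N
  parent_mem : ∀ v ∈ W, p v ∈ W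
  parent_adj : ∀ v ∈ W, v ≠ a → G.Adj v (p v)
  parent_rank : ∀ v ∈ W, v ≠ a → r (p v) < r v
  low_adj : ∀ v ∉ W, G.Adj v (low v)
  low_idx : ∀ v ∉ W, idx (low v) < idx v
  high_adj : ∀ v ∉ W, G.Adj v (high v)
  high_idx : ∀ v ∉ W, high v = a ∨ idx v < idx (high v)

namespace IsHybridData

variable {V : Type*} {G : SimpleGraph V} {a : V} {W : Set V} {idx : V → ℕ}
  {p low high : V → V} {r : V → ℕ} {D N : ℕ}

theorem isRanked (h : IsHybridData G a W idx p low high r D N) {s x : V} {j : ℕ}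
    (hj : j ≤ idx s) (hx : x ∈ W ∨ idx s < idx x) :
    ∃ r', IsRanked a (hybridParent W idx p low high s x j) r' := by
  classical
  refine ⟨fun v => if v ∈ W then r v else
    if idx v < j then D + 1 + idx v else D + 1 + N + (N - idx v), ?_, fun v hv => ?_⟩
  · simp [hybridParent, h.root_mem, h.parent_root]
  · have hD := h.rank_le
    have hN := h.idx_lt
    have ha := h.root_mem
    by_cases hvW : v ∈ W
    · simpa [hybridParent, hvW, h.parent_mem v hvW] using h.parent_rank v hvW hv
    · have hlow := h.low_idx v hvW
      have hhigh := h.high_idx v hvW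
      have hDx := hD x
      have hNx := hN x
      have hNv := hN v
      have hDl := hD (low v)
      have hDh := hD (high v)
      have hNh := hN (high v)
      simp only [hybridParent, hvW, if_false]
      grind

theorem isSpanningTree [Finite V] (h : IsHybridData G a W idx p low high r D N) {s x : V} {j : ℕ}
    (hj : j ≤ idx s) (hx : x ∈ W ∨ idx s < idx x) (hsx : G.Adj s x) :
    IsSpanningTree G (parentGraph (hybridParent W idx p low high s x j)) := by
  obtain ⟨r', hr'⟩ := h.isRanked hj hx
  refine ⟨parentGraph_le hr' fun v hv => ?_, hr'.isTree⟩
  have h₁ := h.parent_adj v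
  have h₂ := h.low_adj v
  have h₃ := h.high_adj v
  unfold hybridParent
  grind

theorem treesAdjacent_succ [Fintype V] [Nontrivial V] (hidx : Function.Injective idx)
    (h : IsHybridData G a W idx p low high r D N) {s x : V} {j : ℕ}
    (hj : j < idx s) (hx : x ∈ W ∨ idx s < idx x) :
    TreesAdjacent a (parentGraph (hybridParent W idx p low high s x j))
      (parentGraph (hybridParent W idx p low high s x (j + 1))) := by
  obtain ⟨r', hr'⟩ := h.isRanked hj.le hx
  by_cases hv : ∃ v, v ∉ W ∧ idx v = j
  · obtain ⟨v, hvW, rfl⟩ := hv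
    refine treesAdjacent_of_eqOn_compl hr' (s := v)
      (fun hva => hvW (hva ▸ h.root_mem)) (fun u hu => ?_) fun u hu => ?_
    · have h₁ := h.parent_mem u
      have h₂ := h.low_idx u
      have h₃ := h.high_idx u
      have h₄ := h.root_mem
      unfold hybridParent
      grind
    · have := hidx.ne hu
      unfold hybridParent
      grind
  · have heq : hybridParent W idx p low high s x j = hybridParent W idx p low high s x (j + 1) := by
      funext u
      unfold hybridParent
      grind
    rw [← heq]
    exact hr'.treesAdjacent_self

theorem treesAdjacent_pivot [Fintype V] (hidx : Function.Injective idx)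
    (h : IsHybridData G a W idx p low high r D N) {s x y : V} (hs : s ∉ W)
    (hx : x ∈ W ∨ idx s < idx x) :
    TreesAdjacent a (parentGraph (hybridParent W idx p low high s x (idx s)))
      (parentGraph (hybridParent W idx p low high s y (idx s))) := by
  obtain ⟨r', hr'⟩ := h.isRanked le_rfl hx
  refine treesAdjacent_of_eqOn_compl hr' (s := s)
    (fun hsa => hs (hsa ▸ h.root_mem)) (fun u hu => ?_) fun u hu => ?_
  · have h₁ := h.parent_mem u
    have h₂ := h.low_idx u
    have h₃ := h.high_idx u
    have h₄ := h.root_mem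
    have h₅ := hidx.ne hu
    unfold hybridParent
    grind
  · unfold hybridParent
    grind

/-- Lowering all the vertices below `s`, moving `s`, and raising these vertices again. -/
theorem exists_sequence [Fintype V] [Nontrivial V] (hidx : Function.Injective idx)
    (h : IsHybridData G a W idx p low high r D N) {s x y : V} (hs : s ∉ W)
    (hx : x ∈ W ∨ idx s < idx x) (hy : y ∈ W ∨ idx s < idx y)
    (hsx : G.Adj s x) (hsy : G.Adj s y) :
    ∃ f : Fin (2 * idx s + 1 + 1) → SimpleGraph V,
      f 0 = parentGraph (hybridParent W idx p low high s x 0) ∧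
      f (Fin.last _) = parentGraph (hybridParent W idx p low high s y 0) ∧
      (∀ i, IsSpanningTree G (f i)) ∧
      ∀ i : Fin (2 * idx s + 1), TreesAdjacent a (f i.castSucc) (f i.succ) := by
  refine ⟨fun i => if i.val ≤ idx s then parentGraph (hybridParent W idx p low high s x i)
    else parentGraph (hybridParent W idx p low high s y (2 * idx s + 1 - i)), ?_, ?_, ?_, ?_⟩
  · simp
  · have : ¬ 2 * idx s + 1 ≤ idx s := by omega
    simp [this]
  · intro i
    dsimp only
    split_ifs with hi
    · exact h.isSpanningTree hi hx hsx
    · exact h.isSpanningTree (by omega) hy hsy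
  · intro i
    simp only [Fin.val_castSucc, Fin.val_succ]
    obtain hi | hi | hi := lt_trichotomy i.val (idx s)
    · rw [if_pos hi.le, if_pos (by omega)]
      exact h.treesAdjacent_succ hidx hi hx
    · rw [if_pos hi.le, if_neg (by omega), hi,
        show 2 * idx s + 1 - (idx s + 1) = idx s by omega]
      exact h.treesAdjacent_pivot hidx hs hx
    · rw [if_neg (by omega), if_neg (by omega)]
      have := i.isLt
      rw [show 2 * idx s + 1 - i.val = 2 * idx s + 1 - (i.val + 1) + 1 by omega]
      exact (h.treesAdjacent_succ hidx (by omega) hy).symm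

end IsHybridData

/-- Let `G` be 2-vertex-connected on `n ≥ 2` vertices, `e 0, …, e (n-1)` an st-numbering of `G`
with `a = e 0`, and `T'` a spanning tree of `G`.  Let `S` be the subtree of `T'` with vertex set
`W ⊊ V` containing `a`, let `(u*, v*)` be the edge of `T'` with `u* ∈ W`, `v* ∉ W` and `v*`
highest-numbered among all such edges, and let `S'` be the subtree of `T'` on `W ∪ {v*}`.
If `T` is a spanning tree of `G` containing `S` in which every vertex outside `W` other than
`e (n-1)` is joined to its highest-numbered neighbor (and `e (n-1)`, if outside `W`, is joined
to `e 0`), and `T̃` is the analogous spanning tree for `S'`, then there is a sequence of at most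
`2 n` spanning trees of `G` from `T` to `T̃` with consecutive trees adjacent. -/
theorem milestone_step {V : Type*} [Fintype V] (G : SimpleGraph V) (a : V)
    (hn : 2 ≤ Fintype.card V) (h2 : TwoConnected G)
    (e : Fin (Fintype.card V) ≃ V)
    (hst : G.Adj (e ⟨0, by omega⟩) (e ⟨Fintype.card V - 1, by omega⟩))
    (hnum : ∀ i : Fin (Fintype.card V), 0 < i.val → i.val < Fintype.card V - 1 →
      ∃ j k : Fin (Fintype.card V), j < i ∧ i < k ∧ G.Adj (e i) (e j) ∧ G.Adj (e i) (e k))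
    (ha : a = e ⟨0, by omega⟩)
    -- the spanning tree `T'` and the subtree `S` of `T'`, with vertex set `W`
    (T' : SimpleGraph V) (hT' : IsSpanningTree G T')
    (W : Set V) (haW : a ∈ W) (hWne : W ≠ Set.univ)
    (hWsub : (T'.induce W).Connected)
    -- the edge `(u*, v*)` of `T'` leaving `W`, with `v*` highest-numbered
    (ustar vstar : V) (hu : ustar ∈ W) (hv : vstar ∉ W) (huv : T'.Adj ustar vstar)
    (hmax : ∀ u v : V, u ∈ W → v ∉ W → T'.Adj u v → e.symm v ≤ e.symm vstar)
    -- the spanning tree `T` associated with `S`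
    (T : SimpleGraph V) (hT : IsSpanningTree G T)
    (hTS : ∀ u v : V, u ∈ W → v ∈ W → T'.Adj u v → T.Adj u v)
    (hThigh : ∀ v : V, v ∉ W → v ≠ e ⟨Fintype.card V - 1, by omega⟩ →
      ∀ w : V, G.Adj v w → (∀ w' : V, G.Adj v w' → e.symm w' ≤ e.symm w) → T.Adj v w)
    (hTlast : e ⟨Fintype.card V - 1, by omega⟩ ∉ W →
      T.Adj (e ⟨Fintype.card V - 1, by omega⟩) (e ⟨0, by omega⟩))
    -- the spanning tree `T̃` associated with `S'`, whose vertex set is `W ∪ {v*}`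
    (T₂ : SimpleGraph V) (hT₂ : IsSpanningTree G T₂)
    (hT₂S : ∀ u v : V, u ∈ insert vstar W → v ∈ insert vstar W → T'.Adj u v → T₂.Adj u v)
    (hT₂high : ∀ v : V, v ∉ insert vstar W → v ≠ e ⟨Fintype.card V - 1, by omega⟩ →
      ∀ w : V, G.Adj v w → (∀ w' : V, G.Adj v w' → e.symm w' ≤ e.symm w) → T₂.Adj v w)
    (hT₂last : e ⟨Fintype.card V - 1, by omega⟩ ∉ insert vstar W →
      T₂.Adj (e ⟨Fintype.card V - 1, by omega⟩) (e ⟨0, by omega⟩)) :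
    ∃ ℓ : ℕ, ∃ f : Fin (ℓ + 1) → SimpleGraph V,
      ℓ + 1 ≤ 2 * Fintype.card V ∧
      f 0 = T ∧ f (Fin.last ℓ) = T₂ ∧
      (∀ i, IsSpanningTree G (f i)) ∧
      (∀ i : Fin ℓ, TreesAdjacent a (f i.castSucc) (f i.succ)) := by
  have : Nontrivial V := Fintype.one_lt_card_iff_nontrivial.1 (by omega)
  obtain ⟨p, r, D, hpa, hrD, hp⟩ := exists_parent_of_connected_induce haW hWsub
  have hlow : ∀ v, ∃ w, v ∉ W → G.Adj v w ∧ e.symm w < e.symm v := by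
    intro v
    by_cases hvW : v ∈ W
    · exact ⟨v, fun h => absurd hvW h⟩
    obtain ⟨i, rfl⟩ := e.surjective v
    have hi0 : 0 < i.val := by
      refine Nat.pos_of_ne_zero fun hi => hvW ?_
      rw [show i = ⟨0, by omega⟩ from Fin.ext hi, ← ha]
      exact haW
    by_cases hi : i.val < Fintype.card V - 1
    · obtain ⟨j, -, hj, -, hadj, -⟩ := hnum i hi0 hi
      exact ⟨e j, fun _ => ⟨hadj, by simpa using hj⟩⟩
    · have hi' : i = ⟨Fintype.card V - 1, by omega⟩ := Fin.ext (by have := i.isLt; dsimp only; omega)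
      refine ⟨e ⟨0, by omega⟩, fun _ => ⟨hi' ▸ hst.symm, ?_⟩⟩
      rw [Equiv.symm_apply_apply, Equiv.symm_apply_apply]
      exact hi0
  choose low hlow using hlow
  have hhigh : ∀ v, ∃ w, v ∉ W → G.Adj v w ∧ (w = a ∨ e.symm v < e.symm w) ∧ T.Adj v w ∧
      (v ≠ vstar → T₂.Adj v w) := by
    intro v
    by_cases hvW : v ∈ W
    · exact ⟨v, fun h => absurd hvW h⟩
    have hmem : v ≠ vstar → v ∉ insert vstar W := fun h => by simp [h, hvW]
    by_cases hlast : v = e ⟨Fintype.card V - 1, by omega⟩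
    · refine ⟨a, fun _ => ?_⟩
      subst hlast
      refine ⟨ha ▸ hst.symm, .inl rfl, ha ▸ hTlast hvW, fun h => ha ▸ hT₂last (hmem h)⟩
    · obtain ⟨w, hw, hwmax⟩ := (Set.toFinite (G.neighborSet v)).exists_maximalFor e.symm _
        ⟨low v, (hlow v hvW).1⟩
      have hwmax' : ∀ w', G.Adj v w' → e.symm w' ≤ e.symm w := fun w' hw' =>
        (le_total _ _).elim id fun h => hwmax hw' h
      refine ⟨w, fun _ => ⟨hw, .inr ?_, hThigh v hvW hlast w hw hwmax',
        fun h => hT₂high v (hmem h) hlast w hw hwmax'⟩⟩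
      obtain ⟨i, rfl⟩ := e.surjective v
      have hi0 : 0 < i.val := by
        refine Nat.pos_of_ne_zero fun hi => hvW ?_
        rw [show i = ⟨0, by omega⟩ from Fin.ext hi, ← ha]
        exact haW
      have hi : i.val < Fintype.card V - 1 := by
        have := i.isLt
        have : i.val ≠ Fintype.card V - 1 := fun h => hlast (congrArg e (Fin.ext h))
        omega
      obtain ⟨-, k, -, hk, -, hadj⟩ := hnum i hi0 hi
      have := hwmax' _ hadj
      rw [Equiv.symm_apply_apply] at this ⊢
      exact hk.trans_le this
  choose high hhigh using hhigh
  have hdata : IsHybridData G a W (fun v => (e.symm v).val) p low high r D (Fintype.card V) :=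
    { root_mem := haW
      parent_root := hpa
      rank_le := hrD
      idx_lt := fun v => (e.symm v).isLt
      parent_mem := fun v hv => (hp v hv).1
      parent_adj := fun v hv hva => hT'.1 ((hp v hv).2 hva).1
      parent_rank := fun v hv hva => ((hp v hv).2 hva).2
      low_adj := fun v hv => (hlow v hv).1
      low_idx := fun v hv => (hlow v hv).2
      high_adj := fun v hv => (hhigh v hv).1
      high_idx := fun v hv => (hhigh v hv).2.1 }
  have hx : high vstar ∈ W ∨ (e.symm vstar).val < (e.symm (high vstar)).val :=
    (hhigh vstar hv).2.1.imp (fun h => by rw [h]; exact haW) id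
  have hidx : Function.Injective fun v => (e.symm v).val :=
    Fin.val_injective.comp e.symm.injective
  obtain ⟨f, hf0, hfl, hfs, hfa⟩ := hdata.exists_sequence hidx hv hx (.inl hu)
    (hhigh vstar hv).1 (hT'.1 huv.symm)
  refine ⟨_, f, ?_, ?_, ?_, hfs, hfa⟩
  · have := (e.symm vstar).isLt
    omega
  · obtain ⟨r', hr'⟩ := hdata.isRanked (Nat.zero_le _) hx
    rw [hf0]
    refine hr'.eq_of_isTree hT.2 fun v hva => ?_
    have h₁ := fun hvW => hTS v (p v) hvW (hp v hvW).1 ((hp v hvW).2 hva).1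
    have h₂ := fun hvW => (hhigh v hvW).2.2.1
    unfold hybridParent
    grind
  · obtain ⟨r', hr'⟩ := hdata.isRanked (s := vstar) (Nat.zero_le _) (.inl hu)
    rw [hfl]
    refine hr'.eq_of_isTree hT₂.2 fun v hva => ?_
    have h₁ := fun hvW => hT₂S v (p v) (.inr hvW) (.inr (hp v hvW).1) ((hp v hvW).2 hva).1
    have h₂ := fun hvW => (hhigh v hvW).2.2.2
    have h₃ := hT₂S vstar ustar (.inl rfl) (.inr hu) huv.symm
    unfold hybridParent
    grind
end

section
/- For every k ≥ 1, the graph G_k on vertex set {v_0, …, v_{4k}} with edge set consisting of (v_0,v_1), (v_0,v_2), the edges (v_{4i+1},v_{4i+2}), (v_{4i+2},v_{4i+3}), (v_{4i+3},v_{4i+4}), (v_{4i+4},v_{4i+1}) for 0 ≤ i ≤ k−1, and the edges (v_{4i+4},v_{4i+5}), (v_{4i+3},v_{4i+6}) for 0 ≤ i ≤ k−2, is 2-vertex-connected. -/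
/-- The underlying relation of the graph `G_k` on `{v_0, …, v_{4k}}` (vertices as naturals). -/
def GkRel (k m n : ℕ) : Prop :=
  (m = 0 ∧ n = 1) ∨ (m = 0 ∧ n = 2) ∨
  (∃ i < k, (m = 4*i+1 ∧ n = 4*i+2) ∨ (m = 4*i+2 ∧ n = 4*i+3) ∨
            (m = 4*i+3 ∧ n = 4*i+4) ∨ (m = 4*i+4 ∧ n = 4*i+1)) ∨
  (∃ i, i + 1 < k ∧ ((m = 4*i+4 ∧ n = 4*i+5) ∨ (m = 4*i+3 ∧ n = 4*i+6)))

/-- The graph `G_k` on the `4k+1` vertices `v_0, …, v_{4k}`. -/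
def Gk (k : ℕ) : SimpleGraph (Fin (4*k+1)) :=
  SimpleGraph.fromRel (fun x y => GkRel k x.val y.val)

/-- The spanning tree `T_k^A` of `G_k`, with edges `e_i = (v_i, v_{i+1})` for `0 ≤ i ≤ 4k-1`. -/
def TkA (k : ℕ) : SimpleGraph (Fin (4*k+1)) :=
  SimpleGraph.fromRel (fun x y => x.val + 1 = y.val)

/-- The underlying relation of the spanning tree `T_k^B` of `G_k`. -/
def TkBRel (k m n : ℕ) : Prop :=
  (m = 0 ∧ n = 1) ∨ (m = 0 ∧ n = 2) ∨
  (∃ i < k, (m = 4*i+1 ∧ n = 4*i+4) ∨ (m = 4*i+2 ∧ n = 4*i+3)) ∨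
  (∃ i, i + 1 < k ∧ ((m = 4*i+4 ∧ n = 4*i+5) ∨ (m = 4*i+3 ∧ n = 4*i+6)))

/-- The spanning tree `T_k^B` of `G_k`. -/
def TkB (k : ℕ) : SimpleGraph (Fin (4*k+1)) :=
  SimpleGraph.fromRel (fun x y => TkBRel k x.val y.val)

/-- A graph is connected if every vertex other than a fixed root has a neighbour on which a given
`ℕ`-valued potential is smaller. -/
theorem SimpleGraph.connected_of_exists_adj_lt {V : Type*} (G : SimpleGraph V) (r : V) (f : V → ℕ)
    (h : ∀ w, w ≠ r → ∃ u, G.Adj w u ∧ f u < f w) : G.Connected := by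
  have reach : ∀ n w, f w = n → G.Reachable w r := by
    intro n
    induction n using Nat.strong_induction_on with
    | _ n ih =>
      intro w hw
      by_cases hr : w = r
      · subst hr
        rfl
      · obtain ⟨u, hu, hlt⟩ := h w hr
        exact hu.reachable.trans (ih (f u) (hw ▸ hlt) u rfl)
  have : Nonempty V := ⟨r⟩
  exact ⟨fun a b => (reach _ a rfl).trans (reach _ b rfl).symm⟩

/-- A connectivity criterion for vertex-deleted subgraphs of `G_k` in terms of vertex indices. -/
theorem Gk_induce_ne_connected {k : ℕ} (v : Fin (4 * k + 1)) (r : ℕ) (f : ℕ → ℕ)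
    (hr : r ≤ 4 * k) (hrv : r ≠ v.val)
    (h : ∀ n ≤ 4 * k, n ≠ v.val → n ≠ r →
      ∃ m ≤ 4 * k, m ≠ v.val ∧ (GkRel k n m ∨ GkRel k m n) ∧ f m < f n) :
    ((Gk k).induce {w | w ≠ v}).Connected := by
  refine SimpleGraph.connected_of_exists_adj_lt _
    ⟨⟨r, by omega⟩, fun e => hrv (congrArg Fin.val e)⟩ (fun w => f w.1.val) ?_
  rintro ⟨⟨n, hn⟩, hnv⟩ hnr
  obtain ⟨m, hm, hmv, hadj, hlt⟩ := h n (by omega) (fun e => hnv (Fin.ext e))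
    (fun e => hnr (Subtype.ext (Fin.ext e)))
  refine ⟨⟨⟨m, by omega⟩, fun e => hmv (congrArg Fin.val e)⟩, ?_, hlt⟩
  simp only [SimpleGraph.comap_adj, Function.Embedding.subtype_apply, Gk,
    SimpleGraph.fromRel_adj]
  refine ⟨fun e => ?_, hadj⟩
  have : n = m := congrArg Fin.val e
  subst this
  exact lt_irrefl _ hlt

/-- The rungs of the ladder `G_k`. -/
theorem GkRel_rung {k n : ℕ} (h : 2 * n + 2 ≤ 4 * k) : GkRel k (2 * n + 1) (2 * n + 2) :=
  Or.inr <| Or.inr <| Or.inl ⟨n / 2, by omega, by omega⟩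

/-- The two neighbours of `v_0` in `G_k`. -/
theorem GkRel_zero {k n : ℕ} (h : n = 1 ∨ n = 2) : GkRel k 0 n := by
  rcases h with rfl | rfl <;> simp [GkRel]

/-- The rail `v_1, v_4, v_5, v_8, …` of `G_k`: each vertex after the first has a predecessor. -/
theorem exists_GkRel_of_mod_lt_two {k n : ℕ} (h : n % 4 < 2) (hn : 2 ≤ n) (hk : n ≤ 4 * k) :
    ∃ m < n, 0 < m ∧ m % 4 < 2 ∧ (GkRel k n m ∨ GkRel k m n) := by
  rcases (by omega : n % 4 = 0 ∨ n % 4 = 1) with h | h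
  · exact ⟨n - 3, by omega, by omega, by omega,
      Or.inl <| Or.inr <| Or.inr <| Or.inl ⟨n / 4 - 1, by omega, by omega⟩⟩
  · exact ⟨n - 1, by omega, by omega, by omega,
      Or.inr <| Or.inr <| Or.inr <| Or.inr ⟨n / 4 - 1, by omega, by omega⟩⟩

/-- The rail `v_2, v_3, v_6, v_7, …` of `G_k`: each vertex after the first has a predecessor. -/
theorem exists_GkRel_of_two_le_mod {k n : ℕ} (h : 2 ≤ n % 4) (hn : 3 ≤ n) (hk : n ≤ 4 * k) :
    ∃ m < n, 2 ≤ m % 4 ∧ (GkRel k n m ∨ GkRel k m n) := by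
  rcases (by omega : n % 4 = 2 ∨ n % 4 = 3) with h | h
  · exact ⟨n - 3, by omega, by omega,
      Or.inr <| Or.inr <| Or.inr <| Or.inr ⟨n / 4 - 1, by omega, by omega⟩⟩
  · exact ⟨n - 1, by omega, by omega,
      Or.inr <| Or.inr <| Or.inr <| Or.inl ⟨n / 4, by omega, by omega⟩⟩

/-- Each vertex of `G_k` other than `v_0` has a neighbour on the opposite rail. -/
theorem exists_GkRel_opposite {k n : ℕ} (hn : 0 < n) (hk : n ≤ 4 * k) :
    ∃ m ≤ 4 * k, 0 < m ∧ m ≤ n + 1 ∧ (m % 4 < 2 ↔ 2 ≤ n % 4) ∧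
      (GkRel k n m ∨ GkRel k m n) := by
  obtain ⟨i, rfl | rfl⟩ : ∃ i, n = 2 * i + 1 ∨ n = 2 * i + 2 := ⟨(n - 1) / 2, by omega⟩
  · exact ⟨2 * i + 2, by omega, by omega, by omega, by omega, Or.inl (GkRel_rung (by omega))⟩
  · exact ⟨2 * i + 1, by omega, by omega, by omega, by omega, Or.inr (GkRel_rung (by omega))⟩

/-- For every `k ≥ 1`, the graph `G_k` is 2-vertex-connected. -/
theorem Gk_twoConnected (k : ℕ) (hk : 1 ≤ k) : TwoConnected (Gk k) := by
  refine ⟨by rw [Fintype.card_fin]; omega, fun v => ?_⟩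
  by_cases hv0 : v.val = 0
  · refine Gk_induce_ne_connected v 1 (fun n => if n % 4 < 2 then n else n + 2)
      (by omega) (by omega) fun n hn hnv hnr => ?_
    by_cases hA : n % 4 < 2
    · obtain ⟨m, hm, hm0, hmA, hadj⟩ := exists_GkRel_of_mod_lt_two hA (by omega) hn
      exact ⟨m, by omega, by omega, hadj, by simpa only [if_pos hmA, if_pos hA]⟩
    · obtain ⟨m, hm, hm0, hmn, hmA, hadj⟩ := exists_GkRel_opposite (by omega) hn
      exact ⟨m, hm, by omega, hadj, by
        rw [if_pos (hmA.2 (by omega)), if_neg hA]; omega⟩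
  by_cases hvA : v.val % 4 < 2
  · refine Gk_induce_ne_connected v 0 (fun n => if n % 4 < 2 ∧ n ≠ 0 then n + 2 else n)
      (by omega) (by omega) fun n hn hnv hnr => ?_
    by_cases hA : n % 4 < 2
    · obtain ⟨m, hm, hm0, hmn, hmA, hadj⟩ := exists_GkRel_opposite (by omega) hn
      exact ⟨m, hm, by grind, hadj, by grind⟩
    · by_cases h2 : n = 2
      · subst h2
        exact ⟨0, by omega, by omega, Or.inr (GkRel_zero (by omega)), by simp⟩
      · obtain ⟨m, hm, hmA, hadj⟩ := exists_GkRel_of_two_le_mod (k := k) (n := n)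
          (by omega) (by omega) hn
        exact ⟨m, by omega, by grind, hadj, by grind⟩
  · refine Gk_induce_ne_connected v 0 (fun n => if n % 4 < 2 then n else n + 2)
      (by omega) (by omega) fun n hn hnv hnr => ?_
    by_cases hA : n % 4 < 2
    · by_cases h1 : n = 1
      · subst h1
        exact ⟨0, by omega, by omega, Or.inr (GkRel_zero (by omega)), by simp⟩
      · obtain ⟨m, hm, hm0, hmA, hadj⟩ := exists_GkRel_of_mod_lt_two hA (by omega) hn
        exact ⟨m, by omega, by grind, hadj, by grind⟩
    · obtain ⟨m, hm, hm0, hmn, hmA, hadj⟩ := exists_GkRel_opposite (by omega) hn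
      exact ⟨m, hm, by grind, hadj, by grind⟩
end

section
/- For every k ≥ 1, both T_k^A, the subgraph of G_k with edge set {e_0, …, e_{4k−1}} where e_i = (v_i, v_{i+1}), and T_k^B, the subgraph of G_k with edge set {(v_0,v_1),(v_0,v_2)} ∪ (⋃_{i=0}^{k−1} {(v_{4i+1},v_{4i+4}),(v_{4i+2},v_{4i+3})}) ∪ (⋃_{i=0}^{k−2} {(v_{4i+4},v_{4i+5}),(v_{4i+3},v_{4i+6})}), are spanning trees of G_k. -/
/-- A graph on a well-founded linear order with a least element is a tree if every other vertex has
exactly one smaller neighbour. -/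
theorem SimpleGraph.isTree_of_existsUnique_lt_adj {V : Type*} [LinearOrder V] [OrderBot V]
    [WellFoundedLT V] {G : SimpleGraph V} (h : ∀ v, v ≠ ⊥ → ∃! u, u < v ∧ G.Adj u v) :
    G.IsTree := by
  have reach (v : V) : G.Reachable ⊥ v := by
    induction v using WellFoundedLT.induction with
    | ind v ih =>
      rcases eq_or_ne v ⊥ with rfl | hv
      · exact .refl _
      · obtain ⟨u, ⟨hlt, hadj⟩, -⟩ := h v hv
        exact (ih u hlt).trans hadj.reachable
  have : Nonempty V := ⟨⊥⟩
  refine ⟨⟨fun u v => (reach u).symm.trans (reach v)⟩, fun v c hc => ?_⟩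
  obtain ⟨w, hw, hmax⟩ := c.support.toFinset.exists_max_image id ⟨v, by simp⟩
  simp only [List.mem_toFinset, id] at hw hmax
  have hc' := hc.rotate hw
  have lt_of_adj {u : V} (hu : u ∈ (c.rotate w hw).support) (ha : G.Adj u w) : u < w :=
    (hmax u ((c.mem_support_rotate_iff w hw).1 hu)).lt_of_ne ha.ne
  have hsnd : (c.rotate w hw).snd < w ∧ G.Adj (c.rotate w hw).snd w :=
    have ha := ((c.rotate w hw).adj_snd hc'.not_nil).symm
    ⟨lt_of_adj ((c.rotate w hw).getVert_mem_support _) ha, ha⟩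
  have hpen : (c.rotate w hw).penultimate < w ∧ G.Adj (c.rotate w hw).penultimate w :=
    have ha := (c.rotate w hw).adj_penultimate hc'.not_nil
    ⟨lt_of_adj ((c.rotate w hw).getVert_mem_support _) ha, ha⟩
  exact hc'.snd_ne_penultimate
    ((h w (ne_bot_of_gt hsnd.1)).unique hsnd hpen)

/-- A relation on `ℕ` that relates only smaller to larger numbers, and every positive `n ≤ N` to
exactly one number, generates a tree on `Fin (N + 1)`. -/
theorem SimpleGraph.isTree_fromRel_fin {N : ℕ} {r : ℕ → ℕ → Prop}
    (hlt : ∀ m n, r m n → m < n) (h : ∀ n, 0 < n → n ≤ N → ∃! m, r m n) :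
    (SimpleGraph.fromRel fun x y : Fin (N + 1) => r x.val y.val).IsTree := by
  refine isTree_of_existsUnique_lt_adj fun v hv => ?_
  have hv0 : 0 < v.val := Fin.pos_iff_ne_zero.2 hv
  obtain ⟨m, hm, huniq⟩ := h v hv0 (by omega)
  have hmv := hlt _ _ hm
  refine ⟨⟨m, by omega⟩, ⟨hmv, ?_⟩, ?_⟩
  · exact (fromRel_adj _ _ _).2 ⟨Fin.ne_of_lt hmv, Or.inl hm⟩
  · rintro u ⟨huv, hadj⟩
    rcases ((fromRel_adj _ _ _).1 hadj).2 with hr | hr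
    · exact Fin.ext (huniq _ hr)
    · exact absurd (hlt _ _ hr) (by simpa using huv.le)

/-- A spanning subgraph given by a relation contained in `GkRel` is a subgraph of `G_k`. -/
theorem fromRel_le_Gk {k : ℕ} {r : ℕ → ℕ → Prop}
    (h : ∀ m n, m ≤ 4 * k → n ≤ 4 * k → r m n → GkRel k m n ∨ GkRel k n m) :
    (SimpleGraph.fromRel fun x y : Fin (4 * k + 1) => r x.val y.val) ≤ Gk k := by
  intro x y hxy
  obtain ⟨hne, hr⟩ := (SimpleGraph.fromRel_adj _ _ _).1 hxy
  refine (SimpleGraph.fromRel_adj _ _ _).2 ⟨hne, ?_⟩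
  rcases hr with hr | hr
  · exact h _ _ (by omega) (by omega) hr
  · exact (h _ _ (by omega) (by omega) hr).symm

theorem GkRel_succ {k m : ℕ} (hm : m < 4 * k) : GkRel k m (m + 1) := by
  rcases Nat.eq_zero_or_pos m with rfl | hpos
  · exact Or.inl ⟨rfl, rfl⟩
  · by_cases h4 : m % 4 = 0
    · exact Or.inr (Or.inr (Or.inr ⟨m / 4 - 1, by omega, by omega⟩))
    · exact Or.inr (Or.inr (Or.inl ⟨m / 4, by omega, by omega⟩))

theorem TkBRel.gkRel_or {k m n : ℕ} (h : TkBRel k m n) : GkRel k m n ∨ GkRel k n m := by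
  rcases h with h | h | ⟨i, hi, h | h⟩ | h
  · exact Or.inl (Or.inl h)
  · exact Or.inl (Or.inr (Or.inl h))
  · exact Or.inr (Or.inr (Or.inr (Or.inl ⟨i, hi, by omega⟩)))
  · exact Or.inl (Or.inr (Or.inr (Or.inl ⟨i, hi, by omega⟩)))
  · exact Or.inl (Or.inr (Or.inr (Or.inr h)))

theorem TkBRel.lt {k m n : ℕ} (h : TkBRel k m n) : m < n := by
  rcases h with h | h | ⟨i, hi, h⟩ | ⟨i, hi, h⟩ <;> omega

theorem TkBRel.left_unique {k m m' n : ℕ} (h : TkBRel k m n) (h' : TkBRel k m' n) : m = m' := by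
  rcases h with h | h | ⟨i, hi, h⟩ | ⟨i, hi, h⟩ <;>
    rcases h' with h' | h' | ⟨j, hj, h'⟩ | ⟨j, hj, h'⟩ <;> omega

theorem exists_TkBRel {k n : ℕ} (hpos : 0 < n) (hn : n ≤ 4 * k) : ∃ m, TkBRel k m n := by
  rcases le_or_gt n 2 with h2 | h2
  · exact ⟨0, by unfold TkBRel; omega⟩
  have : n % 4 < 4 := Nat.mod_lt _ (by omega)
  interval_cases hr : n % 4
  · exact ⟨n - 3, Or.inr (Or.inr (Or.inl ⟨n / 4 - 1, by omega, by omega⟩))⟩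
  · exact ⟨n - 1, Or.inr (Or.inr (Or.inr ⟨n / 4 - 1, by omega, by omega⟩))⟩
  · exact ⟨n - 3, Or.inr (Or.inr (Or.inr ⟨n / 4 - 1, by omega, by omega⟩))⟩
  · exact ⟨n - 1, Or.inr (Or.inr (Or.inl ⟨n / 4, by omega, by omega⟩))⟩

/-- For every `k ≥ 1`, both `T_k^A` and `T_k^B` are spanning trees of `G_k`. -/
theorem TkA_TkB_isSpanningTree (k : ℕ) (hk : 1 ≤ k) :
    IsSpanningTree (Gk k) (TkA k) ∧ IsSpanningTree (Gk k) (TkB k) := by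
  refine ⟨⟨fromRel_le_Gk (r := fun m n => m + 1 = n) ?_,
      SimpleGraph.isTree_fromRel_fin (r := fun m n => m + 1 = n) ?_ ?_⟩,
    ⟨fromRel_le_Gk fun _ _ _ _ h => h.gkRel_or,
      SimpleGraph.isTree_fromRel_fin (fun _ _ h => h.lt) fun n hpos hn => ?_⟩⟩
  · rintro m _ - hn rfl
    exact Or.inl (GkRel_succ hn)
  · intro m n h
    omega
  · exact fun n hpos _ => ⟨n - 1, by grind, by grind⟩
  · obtain ⟨m, hm⟩ := exists_TkBRel hpos hn
    exact ⟨m, hm, fun _ h => h.left_unique hm⟩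
end

section
/- For every k ≥ 1, let T_1, …, T_ℓ be any sequence of spanning trees of G_k with T_1 = T_k^A, T_ℓ = T_k^B, and every pair of consecutive trees adjacent with respect to the specified vertex a = v_0. Then ℓ ≥ 2k(k−1); in particular, the minimum length of such a sequence is Ω(|V_k|²). -/
section Leaf

variable {V : Type*} {T : SimpleGraph V} {W : Set V} {S : SimpleGraph W}

/-- An acyclic graph has no edges inside a vertex set beyond those of a connected subgraph spanning
that set. -/
theorem adj_of_connected_sub_acyclic (hT : T.IsAcyclic) (hS : S.Connected)
    (hST : ∀ u v : W, S.Adj u v → T.Adj u v) {x y : W} (h : T.Adj x y) : S.Adj x y := by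
  obtain ⟨P, hP⟩ := (hS.preconnected x y).exists_isPath
  let φ : S →g T := ⟨Subtype.val, fun {u v} huv => hST u v huv⟩
  have hφ : Function.Injective φ := Subtype.val_injective
  have e := (hT.subsingleton_path _ _).elim ⟨P.map φ, hP.map hφ⟩ (SimpleGraph.Path.singleton h)
  have e' := congrArg (fun p => p.1.length) e
  have hl : P.length = 1 := by
    simpa [SimpleGraph.Path.singleton] using e'
  exact SimpleGraph.Walk.adj_of_length_eq_one hl

/-- In an acyclic graph, a vertex outside a connected subgraph has at most one neighbour in it. -/
theorem neighbor_unique_of_connected_sub_acyclic (hT : T.IsAcyclic) (hS : S.Connected)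
    (hST : ∀ u v : W, S.Adj u v → T.Adj u v) {v : V} (hv : v ∉ W) {x y : W}
    (hx : T.Adj v x) (hy : T.Adj v y) : x = y := by
  by_contra hxy
  obtain ⟨P, hP⟩ := (hS.preconnected x y).exists_isPath
  let φ : S →g T := ⟨Subtype.val, fun {u v} huv => hST u v huv⟩
  have hφ : Function.Injective φ := Subtype.val_injective
  have hxy' : (x : V) ≠ y := fun h => hxy (Subtype.ext h)
  have hQ : (SimpleGraph.Walk.cons hx.symm (SimpleGraph.Walk.cons hy .nil)).IsPath := by
    simp [SimpleGraph.Walk.cons_isPath_iff, hx.ne', hy.ne, hxy']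
  have e := (hT.subsingleton_path _ _).elim ⟨P.map φ, hP.map hφ⟩ ⟨_, hQ⟩
  have hmem : v ∈ (P.map φ).support := by
    have e' : P.map φ = _ := congrArg Subtype.val e
    rw [e']
    simp
  rw [SimpleGraph.Walk.support_map, List.mem_map] at hmem
  obtain ⟨w, -, hw⟩ := hmem
  exact hv (hw ▸ w.2)

/-- Adjacent trees differ by reattaching a common leaf `v ≠ a`. -/
theorem TreesAdjacent.exists_leaf [Fintype V] {a : V} {TA TB : SimpleGraph V}
    (h : TreesAdjacent a TA TB) (hA : TA.IsAcyclic) (hB : TB.IsAcyclic) :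
    ∃ v, v ≠ a ∧ (∀ x y, x ≠ v → y ≠ v → (TA.Adj x y ↔ TB.Adj x y)) ∧
      (∀ x y, TA.Adj v x → TA.Adj v y → x = y) ∧
      (∀ x y, TB.Adj v x → TB.Adj v y → x = y) := by
  obtain ⟨W, haW, hW, S, hS, hAdj⟩ := h
  have hc : Wᶜ.ncard = 1 := by
    have h1 := Set.ncard_add_ncard_compl W
    rw [Nat.card_eq_fintype_card] at h1
    have h2 : 0 < Fintype.card V := Fintype.card_pos_iff.2 ⟨a⟩
    omega
  obtain ⟨v, hv⟩ := Set.ncard_eq_one.1 hc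
  have hmem : ∀ x, x ≠ v → x ∈ W := fun x hx => by
    by_contra hxW
    have : x ∈ Wᶜ := hxW
    rw [hv] at this
    exact hx this
  have hvW : v ∉ W := by
    have : v ∈ Wᶜ := by rw [hv]; rfl
    exact this
  have hSA : ∀ u v : W, S.Adj u v → TA.Adj u v := fun u v h => (hAdj u v h).1
  have hSB : ∀ u v : W, S.Adj u v → TB.Adj u v := fun u v h => (hAdj u v h).2
  refine ⟨v, fun h => hvW (h ▸ haW), fun x y hx hy => ⟨fun h => ?_, fun h => ?_⟩,
    fun x y hx hy => ?_, fun x y hx hy => ?_⟩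
  · exact hSB ⟨x, hmem x hx⟩ ⟨y, hmem y hy⟩
      (adj_of_connected_sub_acyclic hA hS.connected hSA h)
  · exact hSA ⟨x, hmem x hx⟩ ⟨y, hmem y hy⟩
      (adj_of_connected_sub_acyclic hB hS.connected hSB h)
  · exact congrArg Subtype.val (neighbor_unique_of_connected_sub_acyclic hA hS.connected hSA hvW
      (x := ⟨x, hmem x hx.ne'⟩) (y := ⟨y, hmem y hy.ne'⟩) hx hy)
  · exact congrArg Subtype.val (neighbor_unique_of_connected_sub_acyclic hB hS.connected hSB hvW
      (x := ⟨x, hmem x hx.ne'⟩) (y := ⟨y, hmem y hy.ne'⟩) hx hy)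

end Leaf

/-- Reading one letter while counting runs. A letter records which of the two rails is present;
letters with exactly one rail continue or start a run, other letters are skipped. The state holds
the rail of the current run and the number of runs so far. -/
def runStep (s : Option Bool × ℕ) (c : Bool × Bool) : Option Bool × ℕ :=
  if c.1 = c.2 then s else if s.1 = some c.1 then s else (some c.1, s.2 + 1)

/-- The state of the run counter after the first `m` letters of `w`. -/
def runState (w : ℕ → Bool × Bool) : ℕ → Option Bool × ℕ
  | 0 => (none, 0)
  | m + 1 => runStep (runState w m) (w m)

/-- The sum of the numbers of runs over all nonempty prefixes of the first `n` letters. -/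
def runSum (w : ℕ → Bool × Bool) (n : ℕ) : ℕ :=
  ∑ m ∈ Finset.range n, (runState w (m + 1)).2

theorem le_runStep_snd (s : Option Bool × ℕ) (c : Bool × Bool) : s.2 ≤ (runStep s c).2 := by
  unfold runStep; split_ifs <;> simp

theorem runStep_snd_le (s : Option Bool × ℕ) (c : Bool × Bool) :
    (runStep s c).2 ≤ s.2 + 1 := by
  unfold runStep; split_ifs <;> simp

/-- `c d` and `c' d'` are nonempty two-letter words agreeing on one rail and having at most one
occurrence each of the other rail. -/
structure LeafMove (c d c' d' : Bool × Bool) : Prop where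
  left : c.1 || c.2
  right : d.1 || d.2
  left' : c'.1 || c'.2
  right' : d'.1 || d'.2
  move : (c.2 = c'.2 ∧ d.2 = d'.2 ∧ ¬(c.1 ∧ d.1) ∧ ¬(c'.1 ∧ d'.1)) ∨
    (c.1 = c'.1 ∧ d.1 = d'.1 ∧ ¬(c.2 ∧ d.2) ∧ ¬(c'.2 ∧ d'.2))

theorem LeafMove.runStep_eq {c d c' d' : Bool × Bool} (h : LeafMove c d c' d')
    (s : Option Bool × ℕ) : runStep (runStep s c) d = runStep (runStep s c') d' := by
  obtain ⟨h1, h2, h3, h4, h5⟩ := h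
  obtain ⟨a1, a2⟩ := c
  obtain ⟨b1, b2⟩ := d
  obtain ⟨c1, c2⟩ := c'
  obtain ⟨d1, d2⟩ := d'
  obtain ⟨_ | _ | _, r⟩ := s <;>
  revert h1 h2 h3 h4 h5 <;>
  cases a1 <;> cases a2 <;> cases b1 <;> cases b2 <;> cases c1 <;> cases c2 <;> cases d1 <;>
    cases d2 <;> simp [runStep]

theorem runSum_le_succ {w w' : ℕ → Bool × Bool} {n j : ℕ}
    (heq : ∀ i < n, i ≠ j → i ≠ j + 1 → w i = w' i)
    (hmove : j + 1 < n → LeafMove (w j) (w (j + 1)) (w' j) (w' (j + 1))) :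
    runSum w n ≤ runSum w' n + 1 := by
  have hlow : ∀ m ≤ n, m ≤ j → runState w m = runState w' m := by
    intro m
    induction m with
    | zero => intros; rfl
    | succ m ih =>
      intro hm hmj
      rw [runState, runState, ih (by omega) (by omega), heq m (by omega) (by omega) (by omega)]
  have hhigh : ∀ d, j + 2 + d ≤ n → runState w (j + 2 + d) = runState w' (j + 2 + d) := by
    intro d
    induction d with
    | zero =>
      intro hd
      change runStep (runStep (runState w j) (w j)) (w (j + 1)) =
        runStep (runStep (runState w' j) (w' j)) (w' (j + 1))
      rw [hlow j (by omega) le_rfl]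
      exact (hmove (by omega)).runStep_eq _
    | succ d ih =>
      intro hd
      rw [← add_assoc, runState, runState, ih (by omega),
        heq (j + 2 + d) (by omega) (by omega) (by omega)]
  have hterm : ∀ m ∈ Finset.range n,
      (runState w (m + 1)).2 ≤ (runState w' (m + 1)).2 + if m = j then 1 else 0 := by
    intro m hm
    rw [Finset.mem_range] at hm
    rcases lt_trichotomy m j with h | rfl | h
    · rw [hlow (m + 1) (by omega) (by omega)]; omega
    · rw [runState, runState, hlow m (by omega) le_rfl, if_pos rfl]
      exact (runStep_snd_le _ _).trans (Nat.add_le_add_right (le_runStep_snd _ _) 1)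
    · obtain ⟨d, rfl⟩ := Nat.exists_eq_add_of_lt h
      have := hhigh d (by omega)
      rw [show j + d + 1 + 1 = j + 2 + d by omega, this]; omega
  refine (Finset.sum_le_sum hterm).trans ?_
  rw [Finset.sum_add_distrib, Finset.sum_ite_eq']
  unfold runSum
  split_ifs <;> omega

theorem runSum_of_alternating {w : ℕ → Bool × Bool} {n : ℕ}
    (hw : ∀ j < n, w j = (decide (j % 2 = 0), decide (j % 2 = 1))) :
    2 * runSum w n = n * (n + 1) := by
  have hs : ∀ m < n, runState w (m + 1) = (some (decide (m % 2 = 0)), m + 1) := by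
    intro m
    induction m with
    | zero => intro h; simp [runState, hw 0 h, runStep]
    | succ m ih =>
      intro h
      rw [runState, ih (by omega), hw (m + 1) h]
      rcases Nat.mod_two_eq_zero_or_one m with h0 | h0 <;>
        simp [runStep, Nat.add_mod, h0]
  have : runSum w n = ∑ m ∈ Finset.range n, (m + 1) :=
    Finset.sum_congr rfl fun m hm => by rw [hs m (Finset.mem_range.1 hm)]
  rw [this]
  clear this hs hw
  induction n with
  | zero => rfl
  | succ n ih => rw [Finset.sum_range_succ, mul_add, ih]; ring

theorem runSum_of_full {w : ℕ → Bool × Bool} {n : ℕ} (hw : ∀ j < n, w j = (true, true)) :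
    runSum w n = 0 := by
  have hs : ∀ m ≤ n, runState w m = (none, 0) := by
    intro m
    induction m with
    | zero => intros; rfl
    | succ m ih => intro h; simp [runState, ih (by omega), hw m (by omega), runStep]
  exact Finset.sum_eq_zero fun m hm => by rw [hs _ (Finset.mem_range.1 hm)]

/-- The vertices of `G_k` form a ladder with apex `v_0`; this is the vertex at height `j` on the
side starting with `v_1`. -/
def upper (j : ℕ) : ℕ := 2 * j - j % 2

/-- The vertex at height `j` on the side of the ladder starting with `v_2`. -/
def lower (j : ℕ) : ℕ := 2 * j - (j + 1) % 2

/-- Adjacency in a graph on `Fin n`, for vertices given as natural numbers. -/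
def NatAdj {n : ℕ} (T : SimpleGraph (Fin n)) (a b : ℕ) : Prop :=
  ∃ x y : Fin n, x.val = a ∧ y.val = b ∧ T.Adj x y

open Classical in
/-- The letter at height `j`: which of the rails from height `j` to `j + 1` belong to `T`. -/
noncomputable def railWord {n : ℕ} (T : SimpleGraph (Fin n)) (j : ℕ) : Bool × Bool :=
  (decide (NatAdj T (upper j) (upper (j + 1))), decide (NatAdj T (lower j) (lower (j + 1))))

theorem IsSpanningTree.railWord_nonempty {k : ℕ} {T : SimpleGraph (Fin (4 * k + 1))}
    (hT : IsSpanningTree (Gk k) T) {j : ℕ} (hj : j < 2 * k) :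
    (railWord T j).1 || (railWord T j).2 := by
  obtain ⟨P⟩ := hT.2.connected.preconnected (0 : Fin (4 * k + 1)) ⟨2 * j + 1, by omega⟩
  obtain ⟨d, -, hd1, hd2⟩ := P.exists_boundary_dart {v | v.val ≤ 2 * j} (by simp) (by simp)
  have hT1 := hT.1 d.adj
  obtain ⟨⟨x, y⟩, hxy⟩ := d
  simp only [Set.mem_ofPred_eq, not_le] at hd1 hd2
  have key : (x.val = upper j ∧ y.val = upper (j + 1)) ∨
      (x.val = lower j ∧ y.val = lower (j + 1)) := by
    simp only [Gk, SimpleGraph.fromRel_adj, GkRel] at hT1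
    unfold upper lower
    obtain ⟨-, (h | h | ⟨i, hi, h⟩ | ⟨i, hi, h⟩) | (h | h | ⟨i, hi, h⟩ | ⟨i, hi, h⟩)⟩ := hT1 <;>
      omega
  simp only [railWord, Bool.or_eq_true, decide_eq_true_eq]
  exact key.imp (fun h => ⟨x, y, h.1, h.2, hxy⟩) (fun h => ⟨x, y, h.1, h.2, hxy⟩)

theorem natAdj_congr {n : ℕ} {T T' : SimpleGraph (Fin n)} {v : Fin n}
    (h : ∀ x y, x ≠ v → y ≠ v → (T.Adj x y ↔ T'.Adj x y)) {a b : ℕ} (ha : a ≠ v.val)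
    (hb : b ≠ v.val) : NatAdj T a b ↔ NatAdj T' a b := by
  constructor <;> rintro ⟨x, y, rfl, rfl, hxy⟩
  · exact ⟨x, y, rfl, rfl, (h x y (by rintro rfl; exact ha rfl) (by rintro rfl; exact hb rfl)).1 hxy⟩
  · exact ⟨x, y, rfl, rfl, (h x y (by rintro rfl; exact ha rfl) (by rintro rfl; exact hb rfl)).2 hxy⟩

theorem not_natAdj_both {n : ℕ} {T : SimpleGraph (Fin n)} {v : Fin n}
    (h : ∀ x y, T.Adj v x → T.Adj v y → x = y) {a b : ℕ} (hab : a ≠ b) :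
    ¬(NatAdj T a v ∧ NatAdj T v b) := by
  rintro ⟨⟨x, y, hx, hy, hxy⟩, ⟨y', z, hy', hz, hyz⟩⟩
  obtain rfl : y = v := Fin.ext hy
  obtain rfl : y' = y := Fin.ext hy'
  have := h x z hxy.symm hyz
  omega

theorem runSum_railWord_le_succ {k : ℕ} {T T' : SimpleGraph (Fin (4 * k + 1))}
    (hT : IsSpanningTree (Gk k) T) (hT' : IsSpanningTree (Gk k) T')
    (h : TreesAdjacent (0 : Fin (4 * k + 1)) T T') :
    runSum (railWord T) (2 * k) ≤ runSum (railWord T') (2 * k) + 1 := by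
  obtain ⟨v, hv0, hiff, hA, hB⟩ := h.exists_leaf hT.2.isAcyclic hT'.2.isAcyclic
  have hv : v.val ≠ 0 := fun h => hv0 (Fin.ext h)
  obtain ⟨j, hj⟩ : ∃ j, j = (v.val - 1) / 2 := ⟨_, rfl⟩
  have hside : v.val = upper (j + 1) ∨ v.val = lower (j + 1) := by unfold upper lower; omega
  have heq {a b : ℕ} (ha : a ≠ v.val) (hb : b ≠ v.val) := propext (natAdj_congr hiff ha hb)
  refine runSum_le_succ (j := j) (fun i _ h1 h2 => ?_) fun hjk => ?_
  · simp only [railWord]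
    rw [heq, heq] <;> simp only [upper, lower] at hside ⊢ <;> omega
  · refine ⟨hT.railWord_nonempty (by omega), hT.railWord_nonempty hjk,
      hT'.railWord_nonempty (by omega), hT'.railWord_nonempty hjk, ?_⟩
    have hu : upper j ≠ upper (j + 1 + 1) := by unfold upper; omega
    have hl : lower j ≠ lower (j + 1 + 1) := by unfold lower; omega
    simp only [railWord, decide_eq_true_eq]
    rcases hside with hs | hs
    · refine Or.inl ⟨?_, ?_, hs ▸ not_natAdj_both hA hu, hs ▸ not_natAdj_both hB hu⟩ <;>
        rw [heq] <;> unfold lower <;> unfold upper at hs <;> omega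
    · refine Or.inr ⟨?_, ?_, hs ▸ not_natAdj_both hA hl, hs ▸ not_natAdj_both hB hl⟩ <;>
        rw [heq] <;> unfold upper <;> unfold lower at hs <;> omega

theorem natAdj_fromRel {n : ℕ} {r : ℕ → ℕ → Prop} {a b : ℕ} (ha : a < n) (hb : b < n) :
    NatAdj (SimpleGraph.fromRel fun x y : Fin n => r x.val y.val) a b ↔
      a ≠ b ∧ (r a b ∨ r b a) := by
  constructor
  · rintro ⟨x, y, rfl, rfl, hxy⟩
    simpa [SimpleGraph.fromRel_adj, Fin.ext_iff] using hxy
  · intro h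
    exact ⟨⟨a, ha⟩, ⟨b, hb⟩, rfl, rfl, by simpa [SimpleGraph.fromRel_adj, Fin.ext_iff] using h⟩

theorem railWord_TkA {k j : ℕ} (hj : j < 2 * k) :
    railWord (TkA k) j = (decide (j % 2 = 0), decide (j % 2 = 1)) := by
  simp only [railWord, Prod.mk.injEq, decide_eq_decide]
  constructor
  · refine (natAdj_fromRel (r := fun x y => x + 1 = y) ?_ ?_).trans ?_ <;> unfold upper <;> omega
  · refine (natAdj_fromRel (r := fun x y => x + 1 = y) ?_ ?_).trans ?_ <;> unfold lower <;> omega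

theorem railWord_TkB {k j : ℕ} (hj : j < 2 * k) : railWord (TkB k) j = (true, true) := by
  simp only [railWord, Prod.mk.injEq, decide_eq_true_eq]
  constructor
  · refine (natAdj_fromRel (r := TkBRel k) (by unfold upper; omega) (by unfold upper; omega)).2
      ⟨by unfold upper; omega, Or.inl ?_⟩
    unfold TkBRel upper
    rcases Nat.even_or_odd' j with ⟨i, rfl | rfl⟩
    · rcases i with _ | i
      · left; simp
      · right; right; right; exact ⟨i, by omega, by omega⟩
    · right; right; left; exact ⟨i, by omega, by omega⟩
  · refine (natAdj_fromRel (r := TkBRel k) (by unfold lower; omega) (by unfold lower; omega)).2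
      ⟨by unfold lower; omega, Or.inl ?_⟩
    unfold TkBRel lower
    rcases Nat.even_or_odd' j with ⟨i, rfl | rfl⟩
    · rcases i with _ | i
      · right; left; simp
      · right; right; right; exact ⟨i, by omega, by omega⟩
    · right; right; left; exact ⟨i, by omega, by omega⟩

/-- Any sequence of spanning trees of `G_k` starting at `T_k^A`, ending at `T_k^B`, with
consecutive trees adjacent with respect to `a = v_0`, has length at least `2k(k-1)`;
since `|V_k| = 4k+1`, the minimum length of such a sequence is `Ω(|V_k|²)`. -/
theorem Gk_sequence_lower_bound (k : ℕ) (hk : 1 ≤ k) (ℓ : ℕ)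
    (f : Fin (ℓ + 1) → SimpleGraph (Fin (4*k+1)))
    (hf : ∀ i, IsSpanningTree (Gk k) (f i))
    (h0 : f 0 = TkA k) (hl : f (Fin.last ℓ) = TkB k)
    (hadj : ∀ i : Fin ℓ, TreesAdjacent (0 : Fin (4*k+1)) (f i.castSucc) (f i.succ)) :
    2 * k * (k - 1) ≤ ℓ + 1 := by
  have hstep : ∀ i : Fin (ℓ + 1),
      runSum (railWord (f 0)) (2 * k) ≤ runSum (railWord (f i)) (2 * k) + i.val := by
    intro i
    induction i using Fin.induction with
    | zero => simp
    | succ i ih =>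
      have := runSum_railWord_le_succ (hf i.castSucc) (hf i.succ) (hadj i)
      simp only [Fin.val_castSucc, Fin.val_succ] at ih ⊢
      omega
  have hfin := hstep (Fin.last ℓ)
  rw [h0, hl, runSum_of_full fun j hj => railWord_TkB hj, Fin.val_last] at hfin
  have hA := runSum_of_alternating (w := railWord (TkA k)) (n := 2 * k)
    fun j hj => railWord_TkA hj
  obtain ⟨m, rfl⟩ := Nat.exists_eq_add_of_le hk
  simp only [Nat.add_sub_cancel_left]
  nlinarith
end

section
/- For k ≥ 1, let T_1, …, T_ℓ be any sequence of spanning trees of G_k with T_1 = T_k^A, T_ℓ = T_k^B, and every pair of consecutive trees adjacent with respect to a = v_0. For each 0 ≤ i ≤ 4k−1, let t_i be the smallest index t such that e_i ∈ T_t and e_i ∉ T_{t+1} (t_i = ∞ if no such t exists). Then t_i < ∞ for all 1 ≤ i ≤ 4k−1, and t_{4k−1} < t_{4k−2} < ⋯ < t_1. -/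
open SimpleGraph in
/-- A tree on a vertex set `W` contained in an acyclic graph contains every edge inside `W`. -/
lemma SimpleGraph.IsAcyclic.adj_of_isTree_le {V : Type*} {T : SimpleGraph V} (hT : T.IsAcyclic)
    {W : Set V} {S : SimpleGraph W} (hS : S.Connected)
    (hST : ∀ u v : W, S.Adj u v → T.Adj u v) (u v : W) (huv : T.Adj u v) : S.Adj u v := by
  by_contra hn
  have hb := isBridge_iff.1 (isAcyclic_iff_forall_adj_isBridge.1 hT huv)
  let φ : S →g (T.deleteEdges {s((u : V), (v : V))}) :=
    { toFun := fun x => x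
      map_rel' := by
        intro a b hab
        rw [deleteEdges_adj]
        refine ⟨hST a b hab, ?_⟩
        simp only [Set.mem_singleton_iff, Sym2.eq_iff, not_or, not_and]
        refine ⟨fun h1 h2 => hn ?_, fun h1 h2 => hn ?_⟩
        · rwa [← Subtype.ext h1, ← Subtype.ext h2]
        · rw [← Subtype.ext h1, ← Subtype.ext h2]
          exact hab.symm }
  exact hb ((hS.preconnected u v).map φ)

open SimpleGraph in
/-- In an acyclic graph, a vertex outside a connected subgraph has at most one neighbour in it. -/
lemma SimpleGraph.IsAcyclic.eq_of_adj_connected {V : Type*} {T : SimpleGraph V} (hT : T.IsAcyclic)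
    {W : Set V} {S : SimpleGraph W} (hS : S.Connected)
    (hST : ∀ u v : W, S.Adj u v → T.Adj u v) {v : V} (hv : v ∉ W) (x y : W)
    (hx : T.Adj v x) (hy : T.Adj v y) : x = y := by
  by_contra hn
  have hb := isBridge_iff.1 (isAcyclic_iff_forall_adj_isBridge.1 hT hx)
  let φ : S →g (T.deleteEdges {s(v, (x : V))}) :=
    { toFun := fun z => z
      map_rel' := by
        intro a b hab
        rw [deleteEdges_adj]
        refine ⟨hST a b hab, ?_⟩
        simp only [Set.mem_singleton_iff, Sym2.eq_iff, not_or, not_and]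
        exact ⟨fun h => absurd (h ▸ a.2) hv, fun _ h => absurd (h ▸ b.2) hv⟩ }
  refine hb (Reachable.trans (Adj.reachable ?_) ((hS.preconnected y x).map φ))
  rw [deleteEdges_adj]
  refine ⟨hy, ?_⟩
  simp only [Set.mem_singleton_iff, Sym2.eq_iff, not_or, not_and]
  exact ⟨fun _ h => hn (Subtype.ext h).symm, fun h => absurd (h ▸ x.2) hv⟩

/-- Two vertices outside a set missing only one element coincide. -/
lemma Set.eq_of_notMem_of_ncard_eq {V : Type*} [Fintype V] {W : Set V}
    (hW : W.ncard = Fintype.card V - 1) {u v : V} (hu : u ∉ W) (hv : v ∉ W) : u = v := by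
  have h1 := Set.ncard_add_ncard_compl W
  rw [Nat.card_eq_fintype_card] at h1
  have h2 : 0 < Fintype.card V := Fintype.card_pos_iff.2 ⟨u⟩
  exact (Set.ncard_le_one_iff (Set.toFinite _)).1 (by omega : Wᶜ.ncard ≤ 1) hu hv

/-- An edge neither of whose endpoints can be the moved leaf persists in an adjacent tree. -/
lemma TreesAdjacent.adj_of_not_leaf {V : Type*} [Fintype V] {a : V} {T T' : SimpleGraph V}
    (h : TreesAdjacent a T T') (hT : T.IsAcyclic) {u v : V} (huv : T.Adj u v)
    (hu : u = a ∨ ∃ w, w ≠ v ∧ T.Adj u w) (hv : v = a ∨ ∃ w, w ≠ u ∧ T.Adj v w) :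
    T'.Adj u v := by
  obtain ⟨W, haW, hW, S, hS, hSTT'⟩ := h
  have hST : ∀ u v : W, S.Adj u v → T.Adj u v := fun u v h => (hSTT' u v h).1
  have key : ∀ x y : V, T.Adj x y → (x = a ∨ ∃ w, w ≠ y ∧ T.Adj x w) → x ∈ W := by
    rintro x y hxy (rfl | ⟨w, hwy, hxw⟩)
    · exact haW
    · by_contra hx
      have mem : ∀ z, T.Adj x z → z ∈ W := fun z hz => by
        by_contra hzW
        exact hz.ne (Set.eq_of_notMem_of_ncard_eq hW hx hzW)
      exact hwy (congrArg Subtype.val (hT.eq_of_adj_connected hS.connected hST hx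
        ⟨w, mem w hxw⟩ ⟨y, mem y hxy⟩ hxw hxy))
  exact (hSTT' ⟨u, key u v huv hu⟩ ⟨v, key v u huv.symm hv⟩
    (hT.adj_of_isTree_le hS.connected hST _ _ huv)).2

/-- If `0, 1, …, i + 2` is a path in a tree, its edge `(i, i + 1)` survives in every tree adjacent
with respect to `0`. -/
lemma TreesAdjacent.adj_succ {n : ℕ} {T T' : SimpleGraph (Fin (n + 1))}
    (h : TreesAdjacent 0 T T') (hT : T.IsAcyclic) {i : ℕ} (hi : i + 1 < n)
    (hpath : ∀ j, (hj : j ≤ i + 1) → T.Adj ⟨j, by omega⟩ ⟨j + 1, by omega⟩) :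
    T'.Adj ⟨i, by omega⟩ ⟨i + 1, by omega⟩ := by
  refine h.adj_of_not_leaf hT (hpath i (by omega)) ?_
    (.inr ⟨⟨i + 2, by omega⟩, by simp, hpath (i + 1) le_rfl⟩)
  rcases i with _ | i
  · exact .inl rfl
  · exact .inr ⟨⟨i, by omega⟩, by simp; omega, (hpath i (by omega)).symm⟩

/-- As long as item `i` has never been removed, all items up to `i` are still present, provided an
item can only be removed when its successor or some earlier item is absent. -/
lemma forall_le_of_forall_not_removed {N ℓ : ℕ} {E : ℕ → ℕ → Prop} (hE0 : ∀ i < N, E 0 i)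
    (hstep : ∀ m < ℓ, ∀ i, i + 1 < N → (∀ j ≤ i + 1, E m j) → E (m + 1) i)
    {i : ℕ} (hi : i < N) {m : ℕ} (hm : m ≤ ℓ) (h : ∀ m' < m, ¬(E m' i ∧ ¬E (m' + 1) i)) :
    ∀ j ≤ i, E m j := by
  induction m with
  | zero => exact fun j hj => hE0 j (by omega)
  | succ m ih =>
    have hm' := ih (by omega) (fun m' h' => h m' (by omega))
    intro j hj
    rcases hj.eq_or_lt with rfl | hj
    · by_contra hn
      exact h m (by omega) ⟨hm' _ le_rfl, hn⟩
    · exact hstep m (by omega) j (by omega) (fun j' hj' => hm' j' (by omega))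

/-- Given a sequence `f 0, …, f ℓ` of spanning trees of `G_k` from `T_k^A` to `T_k^B` with
consecutive trees adjacent with respect to `a = v_0`, let `t i` (for `0 ≤ i ≤ 4k-1`) be the
smallest index `m` such that the edge `e_i = (v_i, v_{i+1})` belongs to `f m` but not to
`f (m+1)` (and `t i = ⊤` if there is no such `m`).  Then `t i < ⊤` for all `1 ≤ i ≤ 4k-1`,
and `t (4k-1) < t (4k-2) < ⋯ < t 1`. -/
theorem Gk_removal_times (k : ℕ) (hk : 1 ≤ k) (ℓ : ℕ)
    (f : Fin (ℓ + 1) → SimpleGraph (Fin (4*k+1)))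
    (hf : ∀ i, IsSpanningTree (Gk k) (f i))
    (h0 : f 0 = TkA k) (hl : f (Fin.last ℓ) = TkB k)
    (hadj : ∀ i : Fin ℓ, TreesAdjacent (0 : Fin (4*k+1)) (f i.castSucc) (f i.succ))
    (t : ℕ → ℕ∞)
    (ht : ∀ i, (hi : i < 4*k) → t i =
      sInf {x : ℕ∞ | ∃ m : ℕ, ∃ hm : m < ℓ, x = (m : ℕ∞) ∧
        s((⟨i, by omega⟩ : Fin (4*k+1)), (⟨i+1, by omega⟩ : Fin (4*k+1))) ∈
          (f ⟨m, by omega⟩).edgeSet ∧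
        s((⟨i, by omega⟩ : Fin (4*k+1)), (⟨i+1, by omega⟩ : Fin (4*k+1))) ∉
          (f ⟨m+1, by omega⟩).edgeSet}) :
    (∀ i, 1 ≤ i → i ≤ 4*k - 1 → t i ≠ ⊤) ∧
    (∀ i j, 1 ≤ i → i < j → j ≤ 4*k - 1 → t j < t i) := by
  let E : ℕ → ℕ → Prop := fun m i => ∃ (hm : m ≤ ℓ) (hi : i < 4*k),
    (f ⟨m, by omega⟩).Adj ⟨i, by omega⟩ ⟨i + 1, by omega⟩
  have hE0 : ∀ i < 4*k, E 0 i := by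
    intro i hi
    refine ⟨by omega, hi, ?_⟩
    change (f 0).Adj _ _
    rw [h0]
    simp [TkA]
  have hEl : ¬E ℓ 1 := by
    rintro ⟨_, h1, hA⟩
    change (f (Fin.last ℓ)).Adj _ _ at hA
    rw [hl] at hA
    simp only [TkB, SimpleGraph.fromRel_adj, TkBRel] at hA
    obtain ⟨-, hA⟩ := hA
    rcases hA with (h | h | ⟨i, _, h⟩ | ⟨i, _, h⟩) | (h | h | ⟨i, _, h⟩ | ⟨i, _, h⟩) <;> omega
  have hstep : ∀ m < ℓ, ∀ i, i + 1 < 4*k → (∀ j ≤ i + 1, E m j) → E (m + 1) i := by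
    intro m hm i hi h
    exact ⟨hm, by omega, (hadj ⟨m, hm⟩).adj_succ (hf _).2.isAcyclic hi
      (fun j hj => (h j hj).2.2)⟩
  have ht' : ∀ i < 4*k, t i =
      sInf {x : ℕ∞ | ∃ m < ℓ, x = (m : ℕ∞) ∧ E m i ∧ ¬E (m + 1) i} := by
    intro i hi
    rw [ht i hi]
    congr 1
    ext x
    constructor
    · rintro ⟨m, hm, hx, h1, h2⟩
      exact ⟨m, hm, hx, ⟨hm.le, hi, h1⟩, fun h => h2 h.2.2⟩
    · rintro ⟨m, hm, hx, h1, h2⟩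
      exact ⟨m, hm, hx, h1.2.2, fun h => h2 ⟨hm, hi, h⟩⟩
  have hattained : ∀ i, 1 ≤ i → i < 4*k → ∃ m < ℓ, t i = (m : ℕ∞) ∧ E m i ∧ ¬E (m + 1) i := by
    intro i hi1 hi
    rw [ht' i hi]
    refine csInf_mem (s := {x : ℕ∞ | ∃ m < ℓ, x = (m : ℕ∞) ∧ E m i ∧ ¬E (m + 1) i}) ?_
    by_contra hne
    refine hEl (forall_le_of_forall_not_removed hE0 hstep hi le_rfl ?_ 1 hi1)
    exact fun m hm h => hne ⟨m, m, hm, rfl, h⟩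
  refine ⟨fun i hi1 hi => ?_, fun i j hi1 hij hj => ?_⟩
  · obtain ⟨m, -, hm, -⟩ := hattained i hi1 (by omega)
    simp [hm]
  · obtain ⟨m, hm, htm, h1, h2⟩ := hattained i hi1 (by omega)
    have hrem : ∃ m' < m, E m' j ∧ ¬E (m' + 1) j := by
      by_contra! hne
      have hp := forall_le_of_forall_not_removed hE0 hstep (i := j) (by omega) hm.le
        (fun m' hm' h => h.2 (hne m' hm' h.1))
      exact h2 (hstep m hm i (by omega) (fun j' hj' => hp j' (by omega)))
    obtain ⟨m', hm', h'⟩ := hrem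
    rw [htm, ht' j (by omega)]
    exact lt_of_le_of_lt (sInf_le ⟨m', by omega, rfl, h'⟩) (by exact_mod_cast hm')
end

section
/- For k ≥ 1, let T_1, …, T_ℓ be any sequence of spanning trees of G_k with T_1 = T_k^A, T_ℓ = T_k^B, and every pair of consecutive trees adjacent with respect to a = v_0. For each 0 ≤ i ≤ 4k−1, let t_i be the smallest index t such that e_i ∈ T_t and e_i ∉ T_{t+1} (t_i = ∞ if no such t exists). Then for every 0 ≤ i ≤ k−1, the indices t_{4i+2} and t_{4i+3} are finite and satisfy t_{4i+2} − t_{4i+3} ≥ 4k − (4i+4). -/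
/-- `p` sends every vertex of the tree `T` other than the root `a` to its parent. Reachability of
the root is expressed as: every nonempty set of vertices closed under `p` contains `a`. -/
structure IsParentMap {V : Type*} (a : V) (T : SimpleGraph V) (p : V → V) : Prop where
  root : p a = a
  adj_iff : ∀ u v, T.Adj u v ↔ u ≠ v ∧ (p u = v ∨ p v = u)
  root_mem : ∀ Q : Set V, (∀ v ∈ Q, p v ∈ Q) → Q.Nonempty → a ∈ Q

/-- `q` arises from the parent map `p` by changing the parent of at most one vertex, and a vertex
whose parent changes has no children under `p`. -/
def IsLeafMove {V : Type*} (p q : V → V) : Prop :=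
  ∀ u, q u ≠ p u → (∀ w, p w ≠ u) ∧ ∀ w, w ≠ u → q w = p w

theorem IsParentMap.apply_apply_ne {V : Type*} {a : V} {T : SimpleGraph V} {p : V → V}
    (h : IsParentMap a T p) {x : V} (hx : x ≠ a) : p (p x) ≠ x := by
  intro h2
  have := h.root_mem {x, p x} (by rintro v (rfl | rfl) <;> simp [h2]) ⟨x, by simp⟩
  rcases this with rfl | h3
  · exact hx rfl
  · have h4 : a = p x := h3
    rw [← h4, h.root] at h2
    exact hx h2.symm

theorem IsParentMap.apply_ne {V : Type*} {a : V} {T : SimpleGraph V} {p : V → V}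
    (h : IsParentMap a T p) {x : V} (hx : x ≠ a) : p x ≠ x := fun h2 =>
  h.apply_apply_ne hx (by rw [h2, h2])

theorem IsParentMap.adj {V : Type*} {a : V} {T : SimpleGraph V} {p : V → V}
    (h : IsParentMap a T p) {x : V} (hx : x ≠ a) : T.Adj x (p x) :=
  (h.adj_iff _ _).2 ⟨(h.apply_ne hx).symm, .inl rfl⟩

/-- If a connected graph on the complement of `x` lies in a tree `T`, then it is all of `T` away
from `x`, and `x` is a leaf of `T`. -/
theorem adj_iff_and_existsUnique_adj_of_connected_le {V : Type*} {T : SimpleGraph V}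
    (hT : T.IsTree) {x a : V} (ha : a ≠ x) {W : Set V} (hW : ∀ v, v ∈ W ↔ v ≠ x)
    {S : SimpleGraph W} (hS : S.Connected) (hST : ∀ u v : W, S.Adj u v → T.Adj u v) :
    (∀ u v : W, T.Adj u v ↔ S.Adj u v) ∧ ∃! y, T.Adj x y := by
  have hle : S ≤ T.induce W := fun u v h => hST u v h
  have hind : (T.induce W).IsTree := ⟨hS.mono hle, hT.isAcyclic.induce W⟩
  refine ⟨fun u v => ⟨fun h => ?_, hST u v⟩, ?_⟩
  · exact (SimpleGraph.isTree_iff_minimal_connected.1 hind).2 hS hle h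
  · have : Nontrivial V := ⟨a, x, ha⟩
    obtain ⟨y, hy⟩ := hT.connected.preconnected.exists_adj_of_nontrivial x
    refine ⟨y, hy, fun z hz => ?_⟩
    by_contra hzy
    obtain ⟨w⟩ := hS.preconnected ⟨z, (hW z).2 hz.ne'⟩ ⟨y, (hW y).2 hy.ne'⟩
    let φ : S →g T := ⟨Subtype.val, fun {u v} h => hST u v h⟩
    have hb := SimpleGraph.isBridge_iff_forall_walk_mem_edges.1
      (SimpleGraph.isAcyclic_iff_forall_adj_isBridge.1 hT.isAcyclic hy)
      (SimpleGraph.Walk.cons hz (w.map φ))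
    rw [SimpleGraph.Walk.edges_cons, List.mem_cons] at hb
    rcases hb with hb | hb
    · rcases Sym2.eq_iff.1 hb with ⟨-, h⟩ | ⟨h, -⟩
      · exact hzy h.symm
      · exact hz.ne h
    · have hx := SimpleGraph.Walk.fst_mem_support_of_mem_edges _ hb
      rw [SimpleGraph.Walk.support_map, List.mem_map] at hx
      obtain ⟨v, -, hv⟩ := hx
      exact (hW v).1 v.2 hv

/-- Passing to an adjacent tree acts on parent maps as a leaf move. -/
theorem TreesAdjacent.exists_isParentMap {V : Type*} [Fintype V] {a : V} {TA TB : SimpleGraph V}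
    (h : TreesAdjacent a TA TB) (hA : TA.IsTree) (hB : TB.IsTree) {p : V → V}
    (hp : IsParentMap a TA p) : ∃ q, IsParentMap a TB q ∧ IsLeafMove p q := by
  classical
  obtain ⟨W, haW, hcard, S, hS, hST⟩ := h
  have hpos : 0 < Fintype.card V := Fintype.card_pos_iff.2 ⟨a⟩
  obtain ⟨x, hx⟩ : ∃ x, Wᶜ = {x} := by
    rw [← Set.ncard_eq_one, Set.ncard_compl, hcard, Nat.card_eq_fintype_card]
    omega
  have hW : ∀ v, v ∈ W ↔ v ≠ x := fun v => by
    rw [← not_iff_not, ← Set.mem_compl_iff, hx]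
    simp
  have hax : a ≠ x := (hW a).1 haW
  obtain ⟨hA1, yA, -, hyA⟩ := adj_iff_and_existsUnique_adj_of_connected_le hA hax hW
    hS.connected fun u v h => (hST u v h).1
  obtain ⟨hB1, y, hy, hyB⟩ := adj_iff_and_existsUnique_adj_of_connected_le hB hax hW
    hS.connected fun u v h => (hST u v h).2
  have hoff : ∀ u v, u ≠ x → v ≠ x → (TB.Adj u v ↔ TA.Adj u v) := fun u v hu hv =>
    (hB1 ⟨u, (hW u).2 hu⟩ ⟨v, (hW v).2 hv⟩).trans (hA1 ⟨u, (hW u).2 hu⟩ ⟨v, (hW v).2 hv⟩).symm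
  have hleaf : ∀ w, p w ≠ x := by
    intro w hw
    have hwa : w ≠ a := by
      rintro rfl
      exact hax (hp.root.symm.trans hw)
    have h1 := hyA _ (hp.adj hax.symm)
    have h2 : TA.Adj x w := by
      have := hp.adj hwa
      rw [hw] at this
      exact this.symm
    apply hp.apply_apply_ne hwa
    rw [hw, h1, hyA _ h2]
  have hBx : ∀ v, TB.Adj x v ↔ v = y := fun v => ⟨hyB v, fun h => h ▸ hy⟩
  have hxy : x ≠ y := hy.ne
  refine ⟨Function.update p x y, ⟨?_, ?_, ?_⟩, ?_⟩
  · rw [Function.update_of_ne hax, hp.root]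
  · intro u v
    by_cases hu : u = x
    · subst hu
      rw [hBx, Function.update_self]
      by_cases hv : v = u
      · subst hv
        simp [hxy]
      · simp only [Function.update_of_ne hv, hleaf, or_false, ne_eq, Ne.symm hv,
          not_false_eq_true, true_and]
        exact eq_comm
    · by_cases hv : v = x
      · subst hv
        rw [SimpleGraph.adj_comm, hBx, Function.update_self]
        simp only [Function.update_of_ne hu, hleaf, false_or, ne_eq, hu, not_false_eq_true,
          true_and]
        exact eq_comm
      · rw [hoff u v hu hv, hp.adj_iff, Function.update_of_ne hu, Function.update_of_ne hv]
  · rintro Q hQ ⟨v, hv⟩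
    have hcl : ∀ w ∈ Q \ {x}, p w ∈ Q \ {x} := by
      rintro w ⟨hw, hwx⟩
      have := hQ w hw
      rw [Function.update_of_ne hwx] at this
      exact ⟨this, hleaf w⟩
    refine (hp.root_mem (Q \ {x}) hcl ?_).1
    by_cases hvx : v = x
    · subst hvx
      have := hQ v hv
      rw [Function.update_self] at this
      exact ⟨y, this, hxy.symm⟩
    · exact ⟨v, hv, hvx⟩
  · intro u hu
    have : u = x := by
      by_contra h
      exact hu (Function.update_of_ne h _ _)
    subst this
    exact ⟨hleaf, fun w hw => Function.update_of_ne hw _ _⟩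

theorem isLeafMove_refl {V : Type*} (p : V → V) : IsLeafMove p p := fun _ h => absurd rfl h

/-- A sequence of trees, consecutive ones equal or adjacent, has a sequence of parent maps related
by leaf moves. -/
theorem exists_parentMap_seq {V : Type*} [Fintype V] {a : V} {F : ℕ → SimpleGraph V}
    (hF : ∀ m, (F m).IsTree) (hadj : ∀ m, F (m + 1) = F m ∨ TreesAdjacent a (F m) (F (m + 1)))
    {p₀ : V → V} (h₀ : IsParentMap a (F 0) p₀) :
    ∃ p : ℕ → V → V, p 0 = p₀ ∧ (∀ m, IsParentMap a (F m) (p m)) ∧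
      ∀ m, IsLeafMove (p m) (p (m + 1)) := by
  have hstep : ∀ m q, IsParentMap a (F m) q →
      ∃ q', IsParentMap a (F (m + 1)) q' ∧ IsLeafMove q q' := by
    intro m q hq
    rcases hadj m with h | h
    · exact ⟨q, h ▸ hq, isLeafMove_refl q⟩
    · exact h.exists_isParentMap (hF m) (hF (m + 1)) hq
  choose g hg using hstep
  let P : (m : ℕ) → {q : V → V // IsParentMap a (F m) q} := fun m =>
    Nat.rec ⟨p₀, h₀⟩ (fun m q => ⟨g m q.1 q.2, (hg m q.1 q.2).1⟩) m
  exact ⟨fun m => (P m).1, rfl, fun m => (P m).2, fun m => (hg m (P m).1 (P m).2).2⟩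

/-- The parent of `x` is `y` up to time `s` and different from `y` at time `s + 1`. -/
def FirstMove {V : Type*} (p : ℕ → V → V) (x y : V) (s : ℕ) : Prop :=
  (∀ r ≤ s, p r x = y) ∧ p (s + 1) x ≠ y

theorem exists_firstMove {V : Type*} {p : ℕ → V → V} {x y : V} (h₀ : p 0 x = y) {m : ℕ}
    (hm : p m x ≠ y) : ∃ s < m, FirstMove p x y s := by
  classical
  have hex : ∃ n, p n x ≠ y := ⟨m, hm⟩
  have hpos : Nat.find hex ≠ 0 := fun h => by
    have := Nat.find_spec hex
    rw [h] at this
    exact this h₀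
  obtain ⟨s, hs⟩ := Nat.exists_eq_succ_of_ne_zero hpos
  refine ⟨s, ?_, fun r hr => ?_, ?_⟩
  · have := Nat.find_min' hex hm
    omega
  · by_contra h
    have := Nat.find_min' hex h
    omega
  · have := Nat.find_spec hex
    rw [hs] at this
    exact this

/-- Before a vertex moves for the first time, its children must have moved. -/
theorem FirstMove.exists_child {V : Type*} {p : ℕ → V → V}
    (hp : ∀ m, IsLeafMove (p m) (p (m + 1))) {x y z : V} {s : ℕ} (h : FirstMove p x y s)
    (hz : p 0 z = x) : ∃ r < s, FirstMove p z x r :=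
  exists_firstMove hz ((hp s x (by rw [h.1 s le_rfl]; exact h.2)).1 z)

/-- The first time a tree edge is removed is the first time its lower end moves. -/
theorem FirstMove.isLeast {V : Type*} {a : V} {F : ℕ → SimpleGraph V} {p : ℕ → V → V}
    (hF : ∀ m, IsParentMap a (F m) (p m)) (hp : ∀ m, IsLeafMove (p m) (p (m + 1)))
    {x y : V} (hx : x ≠ a) {s : ℕ} (h : FirstMove p x y s) :
    IsLeast {m | (F m).Adj y x ∧ ¬ (F (m + 1)).Adj y x} s := by
  have hadj : ∀ r ≤ s, (F r).Adj y x := fun r hr => by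
    have := (hF r).adj hx
    rw [h.1 r hr] at this
    exact this.symm
  refine ⟨⟨hadj s le_rfl, fun hs => ?_⟩, ?_⟩
  · rcases ((hF (s + 1)).adj_iff _ _).1 hs with ⟨hne, h1 | h1⟩
    · have hxs := h.1 s le_rfl
      have hmove : p (s + 1) y ≠ p s y := by
        intro h2
        apply (hF s).apply_apply_ne hx
        rw [hxs, ← h2, h1]
      exact (hp s y hmove).1 x hxs
    · exact h.2 h1
  · rintro r ⟨-, hr⟩
    by_contra hlt
    exact hr (hadj (r + 1) (by omega))

/-- Distinct vertices move at distinct times. -/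
theorem card_le_of_forall_moved {V : Type*} {p : ℕ → V → V}
    (hp : ∀ m, IsLeafMove (p m) (p (m + 1))) {τ σ : ℕ} (A : Finset V)
    (hA : ∀ v ∈ A, ∃ s, τ ≤ s ∧ s < σ ∧ p (s + 1) v ≠ p s v) : A.card ≤ σ - τ := by
  choose! g hg1 hg2 hg3 using hA
  rw [← Nat.card_Ico]
  refine Finset.card_le_card_of_injOn g (fun v hv => ?_) fun u hu v hv huv => ?_
  · simpa using ⟨hg1 v hv, hg2 v hv⟩
  · by_contra hne
    have h1 := (hp _ u (hg3 u hu)).2 v (Ne.symm hne)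
    rw [huv] at h1
    exact hg3 v hv h1

/-- Suppose every edge of the host graph leaving `A` ends in `x` or `z`. If `z` is a leaf at time
`τ` and `x` is a leaf at time `σ`, then every vertex of `A` moves in between. -/
theorem exists_move_of_leaf {V : Type*} {a x z : V} {F : ℕ → SimpleGraph V} {p : ℕ → V → V}
    (hF : ∀ m, IsParentMap a (F m) (p m)) {τ σ : ℕ} (hτσ : τ ≤ σ) {A : Set V} (haA : a ∉ A)
    (hcut : ∀ v u, v ∈ A → (F τ).Adj v u → u ∈ A ∨ u = x ∨ u = z)
    (hz : ∀ w, p τ w ≠ z) (hx : ∀ w, p σ w ≠ x) (hp : ∀ m, IsLeafMove (p m) (p (m + 1))) :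
    ∀ v ∈ A, ∃ s, τ ≤ s ∧ s < σ ∧ p (s + 1) v ≠ p s v := by
  by_contra! hcon
  obtain ⟨v₀, hv₀A, hv₀⟩ := hcon
  refine haA ((hF τ).root_mem {v | v ∈ A ∧ ∀ s, τ ≤ s → s < σ → p (s + 1) v = p s v} ?_
    ⟨v₀, hv₀A, hv₀⟩).1
  rintro v ⟨hvA, hv⟩
  have hconst : ∀ s, τ ≤ s → s ≤ σ → p s v = p τ v := by
    intro s hs
    induction s, hs using Nat.le_induction with
    | base => exact fun _ => rfl
    | succ s hs ih => exact fun h => (hv s hs (by omega)).trans (ih (by omega))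
  have hva : v ≠ a := fun h => haA (h ▸ hvA)
  refine ⟨?_, fun s hs hsσ => ?_⟩
  · rcases hcut v _ hvA ((hF τ).adj hva) with h | h | h
    · exact h
    · exact absurd ((hconst σ hτσ le_rfl).trans h) (hx v)
    · exact absurd h (hz v)
  · by_contra hne
    exact (hp s _ hne).1 v (hconst s hs hsσ.le)

theorem isParentMap_TkA (k : ℕ) :
    IsParentMap (0 : Fin (4 * k + 1)) (TkA k) fun v => ⟨v.val - 1, by omega⟩ := by
  refine ⟨rfl, fun u v => ?_, ?_⟩
  · simp only [TkA, SimpleGraph.fromRel_adj, ne_eq, Fin.ext_iff]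
    omega
  · rintro Q hQ ⟨⟨n, hn⟩, hv⟩
    induction n with
    | zero => exact hv
    | succ n ih => exact ih (by omega) (hQ _ hv)

theorem Gk_cut {k i : ℕ} {v u : Fin (4 * k + 1)} (hv : 4 * i + 5 ≤ v.val)
    (h : (Gk k).Adj v u) : 4 * i + 5 ≤ u.val ∨ u.val = 4 * i + 3 ∨ u.val = 4 * i + 4 := by
  simp only [Gk, SimpleGraph.fromRel_adj, GkRel] at h
  obtain ⟨-, (h | h | ⟨j, hj, h⟩ | ⟨j, hj, h⟩) | (h | h | ⟨j, hj, h⟩ | ⟨j, hj, h⟩)⟩ := h <;> omega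

theorem not_adj_TkB {k i : ℕ} {u v : Fin (4 * k + 1)} (hu : u.val = 4 * i + 1)
    (hv : v.val = 4 * i + 2) : ¬ (TkB k).Adj u v := by
  intro h
  simp only [TkB, SimpleGraph.fromRel_adj, TkBRel] at h
  obtain ⟨-, (h | h | ⟨j, hj, h⟩ | ⟨j, hj, h⟩) | (h | h | ⟨j, hj, h⟩ | ⟨j, hj, h⟩)⟩ := h <;> omega

theorem card_vertices_ge (k c : ℕ) :
    (Finset.univ.filter fun v : Fin (4 * k + 1) => c ≤ v.val).card = 4 * k + 1 - c := by
  have h := Fin.card_filter_val_lt (n := 4 * k + 1) (m := c)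
  have h2 := Finset.card_filter_add_card_filter_not (s := (Finset.univ : Finset (Fin (4 * k + 1))))
    (fun v => v.val < c)
  simp only [not_lt, Finset.card_univ, Fintype.card_fin] at h2
  omega

/-- Given a sequence `f 0, …, f ℓ` of spanning trees of `G_k` from `T_k^A` to `T_k^B` with
consecutive trees adjacent with respect to `a = v_0`, let `t i` (for `0 ≤ i ≤ 4k-1`) be the
smallest index `m` such that the edge `e_i = (v_i, v_{i+1})` belongs to `f m` but not to
`f (m+1)` (and `t i = ⊤` if there is no such `m`).  Then for every `0 ≤ i ≤ k-1`, the values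
`t (4i+2)` and `t (4i+3)` are finite and `t (4i+2) - t (4i+3) ≥ 4k - (4i+4)`. -/
theorem Gk_removal_gap (k : ℕ) (hk : 1 ≤ k) (ℓ : ℕ)
    (f : Fin (ℓ + 1) → SimpleGraph (Fin (4*k+1)))
    (hf : ∀ i, IsSpanningTree (Gk k) (f i))
    (h0 : f 0 = TkA k) (hl : f (Fin.last ℓ) = TkB k)
    (hadj : ∀ i : Fin ℓ, TreesAdjacent (0 : Fin (4*k+1)) (f i.castSucc) (f i.succ))
    (t : ℕ → ℕ∞)
    (ht : ∀ i, (hi : i < 4*k) → t i =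
      sInf {x : ℕ∞ | ∃ m : ℕ, ∃ hm : m < ℓ, x = (m : ℕ∞) ∧
        s((⟨i, by omega⟩ : Fin (4*k+1)), (⟨i+1, by omega⟩ : Fin (4*k+1))) ∈
          (f ⟨m, by omega⟩).edgeSet ∧
        s((⟨i, by omega⟩ : Fin (4*k+1)), (⟨i+1, by omega⟩ : Fin (4*k+1))) ∉
          (f ⟨m+1, by omega⟩).edgeSet}) :
    ∀ i < k, t (4*i+2) ≠ ⊤ ∧ t (4*i+3) ≠ ⊤ ∧
      t (4*i+3) + ((4*k - (4*i+4) : ℕ) : ℕ∞) ≤ t (4*i+2) := by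
  intro i hi
  let F : ℕ → SimpleGraph (Fin (4 * k + 1)) := fun m => f ⟨min m ℓ, by omega⟩
  have hFf : ∀ m, (hm : m ≤ ℓ) → F m = f ⟨m, by omega⟩ := fun m hm => by
    simp only [F, Nat.min_eq_left hm]
  have hF0 : F 0 = TkA k := (hFf 0 (Nat.zero_le _)).trans h0
  have hFl : F ℓ = TkB k := (hFf ℓ le_rfl).trans hl
  have hFadj : ∀ m, F (m + 1) = F m ∨ TreesAdjacent 0 (F m) (F (m + 1)) := by
    intro m
    by_cases hm : m < ℓ
    · right
      rw [hFf m hm.le, hFf (m + 1) hm]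
      exact hadj ⟨m, hm⟩
    · left
      simp only [F]
      congr 2
      omega
  obtain ⟨p, hp0, hpF, hp⟩ := exists_parentMap_seq (F := F) (fun m => (hf _).2) hFadj
    (hF0 ▸ isParentMap_TkA k)
  have hp0' : ∀ j, (hj : j < 4 * k) → p 0 ⟨j + 1, by omega⟩ = ⟨j, by omega⟩ := fun j hj => by
    rw [hp0]
    rfl
  have ht' : ∀ j, (hj : j < 4 * k) → ∀ s < ℓ,
      FirstMove p ⟨j + 1, by omega⟩ ⟨j, by omega⟩ s → t j = s := by
    intro j hj s hs hfm
    have hleast := hfm.isLeast hpF hp (by simp [Fin.ext_iff])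
    rw [ht j hj]
    refine IsLeast.csInf_eq ⟨⟨s, hs, rfl, ?_⟩, ?_⟩
    · have := hleast.1
      simpa only [Set.mem_ofPred_eq, hFf s hs.le, hFf (s + 1) hs, SimpleGraph.mem_edgeSet] using this
    · rintro _ ⟨m, hm, rfl, h1, h2⟩
      refine Nat.cast_le.2 (hleast.2 ⟨?_, ?_⟩)
      · rw [hFf m hm.le]
        exact h1
      · rw [hFf (m + 1) hm]
        exact h2
  have hlast : p ℓ ⟨4 * i + 1 + 1, by omega⟩ ≠ ⟨4 * i + 1, by omega⟩ := by
    intro h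
    have h2 := (hpF ℓ).adj (x := ⟨4 * i + 1 + 1, by omega⟩) (by simp [Fin.ext_iff])
    rw [h, hFl] at h2
    exact not_adj_TkB rfl rfl h2.symm
  obtain ⟨s₂, hs₂, hfm₂⟩ := exists_firstMove (hp0' (4 * i + 1) (by omega)) hlast
  obtain ⟨σ, hσ, hfmσ⟩ := hfm₂.exists_child hp (hp0' (4 * i + 2) (by omega))
  obtain ⟨τ, hτ, hfmτ⟩ := hfmσ.exists_child hp (hp0' (4 * i + 3) (by omega))
  rw [ht' (4 * i + 2) (by omega) σ (by omega) hfmσ, ht' (4 * i + 3) (by omega) τ (by omega) hfmτ]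
  refine ⟨ENat.natCast_ne_top _, ENat.natCast_ne_top _, ?_⟩
  have hleafτ := (hp τ _ (by rw [hfmτ.1 τ le_rfl]; exact hfmτ.2)).1
  have hleafσ := (hp σ _ (by rw [hfmσ.1 σ le_rfl]; exact hfmσ.2)).1
  have hmoves := exists_move_of_leaf hpF hτ.le
    (A := {v : Fin (4 * k + 1) | 4 * i + 5 ≤ v.val}) (by simp)
    (fun v u hv huv => by
      simpa only [Set.mem_ofPred_eq, Fin.ext_iff] using Gk_cut hv ((hf _).1 huv))
    hleafτ hleafσ hp
  have hcard := card_le_of_forall_moved hp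
    (Finset.univ.filter fun v : Fin (4 * k + 1) => 4 * i + 5 ≤ v.val)
    (fun v hv => hmoves v (by simpa using hv))
  rw [card_vertices_ge] at hcard
  have : τ + (4 * k - (4 * i + 4)) ≤ σ := by omega
  exact_mod_cast this
end
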